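/- arXiv:math/9712244 — 2 statements merged into one kernel-verified Lean document; each statement's English description precedes it below -/
import Mathlib

section
/- For positive integers a, b, c, the number of rhombus tilings (by unit rhombi with angles 60° and 120°) of a hexagon with side lengths a,b,c,a,b,c and all angles 120° equals the number of plane partitions contained in an a×b×c box, which equals the triple product ∏_{i=1}^{a} ∏_{j=1}^{b} ∏_{k=1}^{c} (i+j+k-1)/(i+j+k-2). -/
/-- A unit triangle of the triangular lattice: `(i, j, d)` where `d = false`
denotes the upward triangle with corners `(i,j), (i+1,j), (i,j+1)` (in lattice
coordinates) and `d = true` the downward triangle with corners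
`(i+1,j), (i,j+1), (i+1,j+1)`. -/
abbrev Triangle := ℤ × ℤ × Bool

/-- The triangles making up the hexagon with side lengths `a,b,c,a,b,c`
(bottom side `a`, then sides `b` and `c` counterclockwise), all angles 120°. -/
def inHexagon (a b c : ℕ) (t : Triangle) : Prop :=
  -(c : ℤ) ≤ t.1 ∧ t.1 ≤ (a : ℤ) - 1 ∧ 0 ≤ t.2.1 ∧ t.2.1 ≤ (b : ℤ) + c - 1 ∧
  (if t.2.2 then -1 ≤ t.1 + t.2.1 ∧ t.1 + t.2.1 ≤ (a : ℤ) + b - 2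
   else 0 ≤ t.1 + t.2.1 ∧ t.1 + t.2.1 ≤ (a : ℤ) + b - 1)

/-- A rhombus (lozenge) tile: `(i, j, d)` is the unit rhombus consisting of the
upward triangle `(i,j)` together with an adjacent downward triangle: the one at
`(i,j)` if `d = 0`, at `(i-1,j)` if `d = 1`, and at `(i,j-1)` if `d = 2`
(the three orientations of a unit rhombus with angles 60° and 120°). -/
abbrev Tile := ℤ × ℤ × Fin 3

/-- The two unit triangles covered by a rhombus tile. -/
def covers (t : Tile) (x : Triangle) : Prop :=
  x = (t.1, t.2.1, false) ∨
  x = (if t.2.2 = 0 then (t.1, t.2.1, true)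
       else if t.2.2 = 1 then (t.1 - 1, t.2.1, true)
       else (t.1, t.2.1 - 1, true))

/-- `T` is a rhombus tiling of the hexagon with sides `a,b,c,a,b,c`: every tile
stays inside the hexagon and every unit triangle of the hexagon is covered by
exactly one tile. -/
def IsTiling (a b c : ℕ) (T : Set Tile) : Prop :=
  (∀ t ∈ T, ∀ x, covers t x → inHexagon a b c x) ∧
  (∀ x, inHexagon a b c x → ∃! t, t ∈ T ∧ covers t x)

/-- The determinant with entries `(l i).choose j`, a Vandermonde determinant up to normalization. -/
def chooseDet (n : ℕ) (l : Fin n → ℕ) : ℚ :=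
  (Matrix.of fun i j : Fin n => ((l i).choose j : ℚ)).det

theorem prod_factorial_mul_chooseDet (n : ℕ) (l : Fin n → ℕ) :
    (∏ i : Fin n, ((i : ℕ).factorial : ℚ)) * chooseDet n l =
      ∏ i : Fin n, ∏ j ∈ Finset.Ioi i, ((l j : ℚ) - l i) := by
  have h := Matrix.det_eval_matrixOfPolynomials_eq_det_vandermonde (fun i => (l i : ℚ))
    (fun i : Fin n => descPochhammer ℚ i) (fun i => descPochhammer_natDegree ℚ i)
    (fun i => monic_descPochhammer ℚ i)
  rw [← Matrix.det_vandermonde, h, chooseDet, ← Matrix.det_mul_row]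
  congr 1
  ext i j
  simp [descPochhammer_eval_eq_descFactorial, Nat.descFactorial_eq_factorial_mul_choose]

theorem chooseDet_id (n : ℕ) : chooseDet n (fun i => i) = 1 := by
  rw [chooseDet, Matrix.det_of_isLowerTriangular]
  · simp
  · intro i j hij
    have : (i : ℕ) < j := hij
    simp [Nat.choose_eq_zero_of_lt this]

theorem chooseDet_eq_prod (n : ℕ) (l : Fin n → ℕ) :
    chooseDet n l = ∏ i : Fin n, ∏ j ∈ Finset.Ioi i, (((l j : ℚ) - l i) / ((j : ℚ) - i)) := by
  have h := prod_factorial_mul_chooseDet n l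
  have h1 := prod_factorial_mul_chooseDet n (fun i => i)
  rw [chooseDet_id, mul_one] at h1
  have h0 : (∏ i : Fin n, ((i : ℕ).factorial : ℚ)) ≠ 0 :=
    Finset.prod_ne_zero_iff.2 fun i _ => by positivity
  simp only [Finset.prod_div_distrib]
  rw [← h, ← h1]
  field_simp

theorem sum_Ico_choose {x y : ℕ} (h : x ≤ y) (k : ℕ) :
    ∑ m ∈ Finset.Ico x y, (m.choose k : ℚ) = y.choose (k + 1) - x.choose (k + 1) := by
  induction y, h using Nat.le_induction with
  | base => simp
  | succ y h ih =>
    rw [Finset.sum_Ico_succ_top h, ih, Nat.choose_succ_succ]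
    push_cast
    ring

/-- Branching rule: summing `chooseDet` over all sequences interlacing with `l`. -/
theorem sum_chooseDet_interlacing (n : ℕ) (l : Fin (n + 1) → ℕ) (hl : Monotone l) :
    ∑ m ∈ Fintype.piFinset (fun i : Fin n => Finset.Ico (l i.castSucc) (l i.succ)),
      chooseDet n m = chooseDet (n + 1) l := by
  have h1 := (Matrix.detRowAlternating (R := ℚ) (n := Fin n)).toMultilinearMap.map_sum_finset
    (fun (_ : Fin n) (m : ℕ) => fun j : Fin n => (m.choose j : ℚ))
    (fun i : Fin n => Finset.Ico (l i.castSucc) (l i.succ))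
  refine (Eq.trans ?_ h1.symm).trans ?_
  · rfl
  rw [chooseDet, Matrix.det_eq_of_forall_row_eq_smul_add_pred
    (B := Matrix.of fun i j : Fin (n + 1) => Fin.cases ((l 0).choose j : ℚ)
      (fun i' => ((l i'.succ).choose j : ℚ) - (l i'.castSucc).choose j) i) (fun _ => 1)]
  · rw [Matrix.det_succ_column_zero, Fin.sum_univ_succ, Finset.sum_eq_zero]
    · simp only [Fin.val_zero, pow_zero, one_mul, Matrix.of_apply, Fin.cases_zero,
        Nat.choose_zero_right, Nat.cast_one, add_zero]
      refine congrArg Matrix.det ?_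
      ext i j
      simp only [Matrix.submatrix_apply, Matrix.of_apply, Fin.zero_succAbove, Fin.cases_succ,
        Finset.sum_apply, Fin.val_succ]
      exact sum_Ico_choose (hl (Fin.castSucc_lt_succ).le) _
    · intro i _
      simp
  · intro j; simp
  · intro i j; simp

theorem chooseDet_rectangle (a b c : ℕ) :
    chooseDet (b + a) (fun s => if (s : ℕ) < b then s else s + c) =
      ∏ i ∈ Finset.Icc 1 a, ∏ j ∈ Finset.Icc 1 b, ∏ k ∈ Finset.Icc 1 c,
        ((i + j + k - 1 : ℚ) / (i + j + k - 2)) := by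
  have hk : ∀ i j : ℕ, 1 ≤ i → 1 ≤ j → ∏ k ∈ Finset.Icc 1 c,
      ((i + j + k - 1 : ℚ) / (i + j + k - 2)) = (i + j + c - 1) / (i + j - 1) := by
    intro i j hi hj
    have hi : (1 : ℚ) ≤ i := by exact_mod_cast hi
    have hj : (1 : ℚ) ≤ j := by exact_mod_cast hj
    induction c with
    | zero => simp; rw [div_self]; linarith
    | succ c ih =>
      rw [Finset.prod_Icc_succ_top (by omega), ih]
      have h0 : (0 : ℚ) ≤ c := by positivity
      have h1 : (i + j - 1 : ℚ) ≠ 0 := by linarith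
      have h2 : (i + j + c - 1 : ℚ) ≠ 0 := by linarith
      have h3 : (i + j + ((c + 1 : ℕ) : ℚ) - 2 : ℚ) = i + j + c - 1 := by push_cast; ring
      rw [h3]
      field_simp
  rw [Finset.prod_congr rfl fun i hi => Finset.prod_congr rfl fun j hj =>
    hk i j (Finset.mem_Icc.1 hi).1 (Finset.mem_Icc.1 hj).1, chooseDet_eq_prod]
  have hI : ∀ i : Fin (b + a), Finset.Ioi i = Finset.univ.filter (fun j => i < j) := by
    intro i; ext; simp
  have hR : ∀ (n : ℕ) (F : ℕ → ℚ), ∏ i ∈ Finset.Icc 1 n, F i = ∏ i : Fin n, F (i + 1) := by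
    intro n F
    rw [Fin.prod_univ_eq_prod_range (fun i => F (i + 1)) n, Finset.range_eq_Ico,
      Finset.prod_Ico_add' F 0 n 1]
    rfl
  simp only [hI, Finset.prod_filter, hR]
  rw [Fin.prod_univ_add, mul_comm, Finset.prod_eq_one, one_mul]
  · rw [← Equiv.prod_comp Fin.revPerm]
    refine Eq.trans ?_ Finset.prod_comm
    refine Finset.prod_congr rfl fun i _ => ?_
    rw [Fin.prod_univ_add, Finset.prod_eq_one, one_mul]
    · refine Finset.prod_congr rfl fun j _ => ?_
      have hi := i.2
      have : (((Fin.rev i : Fin b) : ℕ) : ℚ) = b - 1 - i := by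
        rw [Fin.val_rev, Nat.cast_sub (by omega)]; push_cast; ring
      rw [if_pos (by rw [Fin.lt_def]; simp; omega)]
      simp only [Fin.revPerm_apply, Fin.val_natAdd, Fin.val_castAdd, Fin.is_lt, if_true]
      rw [if_neg (by omega)]
      push_cast
      rw [this]
      congr 1 <;> ring
    · intro j _
      by_cases h : Fin.castAdd a (Fin.revPerm i) < Fin.castAdd a j
      · have h' : ((Fin.castAdd a (Fin.revPerm i) : Fin (b + a)) : ℚ) <
            ((Fin.castAdd a j : Fin (b + a)) : ℚ) := by exact_mod_cast h
        rw [if_pos h, if_pos (show ((Fin.castAdd a j : Fin (b + a)) : ℕ) < b from j.2),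
          if_pos (show ((Fin.castAdd a (Fin.revPerm i) : Fin (b + a)) : ℕ) < b from
            (Fin.revPerm i).2), div_self]
        exact sub_ne_zero.2 h'.ne'
      · rw [if_neg h]
  · intro i _
    refine Finset.prod_eq_one fun j _ => ?_
    by_cases h : Fin.natAdd b i < j
    · have h' : ((Fin.natAdd b i : Fin (b + a)) : ℕ) < j := h
      have h1 : b ≤ ((Fin.natAdd b i : Fin (b + a)) : ℕ) := by simp
      rw [if_pos h, if_neg (by omega), if_neg (by omega)]
      have h2 : (((Fin.natAdd b i : Fin (b + a)) : ℕ) : ℚ) < ((j : ℕ) : ℚ) := by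
        exact_mod_cast h'
      rw [Nat.cast_add, Nat.cast_add, add_sub_add_right_eq_sub, div_self]
      exact sub_ne_zero.2 h2.ne'
    · rw [if_neg h]

/-- Strict Gelfand–Tsetlin patterns with top row `l`, stored as arrays `R` whose `k`-th row is
`R k 0, …, R k (k - 1)` for `k ≤ n` and all of whose other entries vanish. -/
def gtPatterns (n : ℕ) (l : Fin n → ℕ) : Set (ℕ → ℕ → ℕ) :=
  {R | (∀ s : Fin n, R n s = l s) ∧ (∀ k s, n < k ∨ k ≤ s → R k s = 0) ∧
    ∀ k s, k < n → s < k → R (k + 1) s ≤ R k s ∧ R k s < R (k + 1) (s + 1)}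

/-- The rows that may stand directly below the row `l` of a strict Gelfand–Tsetlin pattern. -/
def interlacing {n : ℕ} (l : Fin (n + 1) → ℕ) : Finset (Fin n → ℕ) :=
  Fintype.piFinset fun i : Fin n => Finset.Ico (l i.castSucc) (l i.succ)

theorem mem_interlacing {n : ℕ} {l : Fin (n + 1) → ℕ} {m : Fin n → ℕ} :
    m ∈ interlacing l ↔ ∀ i, l i.castSucc ≤ m i ∧ m i < l i.succ := by
  simp [interlacing]

theorem monotone_of_mem_interlacing {n : ℕ} {l : Fin (n + 1) → ℕ} {m : Fin n → ℕ}
    (hm : m ∈ interlacing l) : Monotone m := by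
  rw [mem_interlacing] at hm
  cases n with
  | zero => exact fun i => i.elim0
  | succ n =>
    refine Fin.monotone_iff_le_succ.2 fun i => ?_
    have h1 := (hm i.castSucc).2
    have h2 := (hm i.succ).1
    rw [← Fin.succ_castSucc] at h2
    omega

/-- Removing the top row of a pattern. -/
noncomputable def gtPatternsSuccEquiv (n : ℕ) (l : Fin (n + 1) → ℕ) :
    gtPatterns (n + 1) l ≃ Σ m : interlacing l, gtPatterns n m := by
  refine Equiv.ofBijective (fun R => ⟨⟨fun s => R.1 n s, ?_⟩,
    ⟨fun k s => if k = n + 1 then 0 else R.1 k s, ?_⟩⟩) ⟨?_, ?_⟩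
  · rw [mem_interlacing]
    intro i
    have h := R.2.2.2 n i (by omega) i.2
    have h1 := R.2.1 i.castSucc
    have h2 := R.2.1 i.succ
    simp only [Fin.val_castSucc, Fin.val_succ] at h1 h2
    omega
  · obtain ⟨R, h1, h2, h3⟩ := R
    refine ⟨fun s => by simp, fun k s hk => ?_, fun k s hk hs => ?_⟩
    · dsimp only
      split_ifs with h
      · rfl
      · exact h2 k s (by omega)
    · simp only [show k ≠ n + 1 by omega, show k + 1 ≠ n + 1 by omega, if_false]
      exact h3 k s (by omega) hs
  · rintro ⟨R, hR⟩ ⟨R', hR'⟩ h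
    have h2 := congrArg (fun x : Σ m : interlacing l, gtPatterns n m => x.2.1) h
    ext k s
    by_cases hk : k = n + 1
    · subst hk
      by_cases hs : s < n + 1
      · exact (hR.1 ⟨s, hs⟩).trans (hR'.1 ⟨s, hs⟩).symm
      · exact (hR.2.1 _ s (by omega)).trans (hR'.2.1 _ s (by omega)).symm
    · simpa [hk] using congrFun (congrFun h2 k) s
  · rintro ⟨⟨m, hm⟩, R, hR⟩
    obtain ⟨h1, h2, h3⟩ := hR
    refine ⟨⟨fun k s => if k = n + 1 then (if h : s < n + 1 then l ⟨s, h⟩ else 0) else R k s,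
      fun s => (if_pos rfl).trans (dif_pos s.2), fun k s hk => ?_, fun k s hk hs => ?_⟩, ?_⟩
    · dsimp only
      by_cases h : k = n + 1
      · rw [if_pos h, dif_neg (by omega)]
      · rw [if_neg h, h2 k s (by omega)]
    · by_cases hkn : k = n
      · subst hkn
        have := mem_interlacing.1 hm ⟨s, hs⟩
        have h4 : R k s = m ⟨s, hs⟩ := h1 ⟨s, hs⟩
        simp only [show k ≠ k + 1 by omega, show s < k + 1 by omega,
          show s + 1 < k + 1 by omega, if_true, if_false, dif_pos, h4]
        exact this
      · simp only [show k ≠ n + 1 by omega, show k + 1 ≠ n + 1 by omega, if_false]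
        exact h3 k s (by omega) hs
    · refine Sigma.subtype_ext ?_ ?_
      · ext s
        simpa using h1 s
      · ext k s
        by_cases hk : k = n + 1
        · simp [hk, h2]
        · simp [hk]

theorem card_gtPatterns (n : ℕ) (l : Fin n → ℕ) (hl : Monotone l) :
    Finite (gtPatterns n l) ∧ (Nat.card (gtPatterns n l) : ℚ) = chooseDet n l := by
  induction n with
  | zero =>
    have h : gtPatterns 0 l = {fun _ _ => 0} := by
      ext R
      refine ⟨fun h => ?_, ?_⟩
      · ext k s
        exact h.2.1 k s (by omega)
      · rintro rfl
        exact ⟨fun s => s.elim0, fun _ _ _ => rfl, fun _ _ h => by omega⟩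
    rw [h]
    exact ⟨inferInstance, by simp [chooseDet]⟩
  | succ n ih =>
    have h := fun m : interlacing l => ih m.1 (monotone_of_mem_interlacing m.2)
    have := fun m => (h m).1
    refine ⟨.of_equiv _ (gtPatternsSuccEquiv n l).symm, ?_⟩
    rw [Nat.card_congr (gtPatternsSuccEquiv n l), Nat.card_sigma, Nat.cast_sum,
      ← sum_chooseDet_interlacing n l hl]
    exact (Finset.sum_congr rfl fun m _ => (h m).2).trans
      (Finset.sum_coe_sort (interlacing l) (chooseDet n))

/-- Plane partitions in an `a × b × c` box with columns reversed, extended to arrays on `ℕ × ℕ`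
that decrease in the first and increase in the second index. -/
def boxArrays (a b c : ℕ) : Set (ℕ → ℕ → ℕ) :=
  {G | (∀ p r, G (p + 1) r ≤ G p r ∧ G p r ≤ G p (r + 1)) ∧ (∀ p r, b ≤ r → G p r = c) ∧
    ∀ p r, a ≤ p → r < b → G p r = 0}

theorem boxArrays_mono {a b c : ℕ} {G : ℕ → ℕ → ℕ} (hG : G ∈ boxArrays a b c) {p p' r r' : ℕ}
    (hp : p ≤ p') (hr : r' ≤ r) : G p' r' ≤ G p r :=
  (antitone_nat_of_succ_le (f := fun p => G p r') (fun p => (hG.1 p r').1) hp).trans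
    (monotone_nat_of_le_succ (f := G p) (fun r => (hG.1 p r).2) hr)

theorem boxArrays_le {a b c : ℕ} {G : ℕ → ℕ → ℕ} (hG : G ∈ boxArrays a b c) (p r : ℕ) :
    G p r ≤ c :=
  (boxArrays_mono hG le_rfl (Nat.le_add_right r b)).trans_eq (hG.2.1 _ _ (by omega))

/-- Plane partitions in a box as arrays on `ℕ × ℕ`. -/
def planePartitionEquiv (a b c : ℕ) :
    {f : Fin a → Fin b → ℕ //
      (∀ i i' j j', i ≤ i' → j ≤ j' → f i' j' ≤ f i j) ∧ (∀ i j, f i j ≤ c)} ≃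
      boxArrays a b c where
  toFun f := ⟨fun p r => if hr : b ≤ r then c else if hp : a ≤ p then 0 else
      f.1 ⟨p, by omega⟩ ⟨b - 1 - r, by omega⟩, by
    obtain ⟨f, hf, hc⟩ := f
    refine ⟨fun p r => ⟨?_, ?_⟩, fun p r h => by simp [h], fun p r hp hr => ?_⟩
    · dsimp only
      split_ifs
      · exact le_rfl
      · exact le_rfl
      · exact Nat.zero_le _
      · omega
      · exact hf _ _ _ _ (Fin.mk_le_mk.2 (by omega)) (Fin.mk_le_mk.2 (by omega))
    · dsimp only
      split_ifs <;> first | omega | exact Nat.zero_le _ | exact hc _ _ | skip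
      exact hf _ _ _ _ le_rfl (Fin.mk_le_mk.2 (by omega))
    · simp [hp, Nat.not_le.2 hr]⟩
  invFun G := ⟨fun p q => G.1 p (b - 1 - q), fun i i' j j' hi hj =>
    boxArrays_mono G.2 hi (by have : (j : ℕ) ≤ j' := hj; omega), fun i j => boxArrays_le G.2 _ _⟩
  left_inv f := by
    refine Subtype.ext ?_
    funext p q
    have hp := p.2
    have hq := q.2
    dsimp only
    rw [dif_neg (by omega), dif_neg (by omega)]
    exact congrArg (f.1 p) (Fin.ext (show b - 1 - (b - 1 - (q : ℕ)) = q by omega))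
  right_inv G := by
    refine Subtype.ext ?_
    funext p r
    dsimp only
    split_ifs with hr hp
    · exact (G.2.2.1 p r hr).symm
    · exact (G.2.2.2 p r hp (by omega)).symm
    · exact congrArg (G.1 p) (show b - 1 - (b - 1 - r) = r by omega)

/-- The top row of the Gelfand–Tsetlin patterns encoding plane partitions in a box. -/
def boxRow (a b c : ℕ) (s : Fin (b + a)) : ℕ := if (s : ℕ) < b then s else s + c

theorem monotone_boxRow (a b c : ℕ) : Monotone (boxRow a b c) := by
  intro s t h
  have : (s : ℕ) ≤ t := h
  simp only [boxRow]
  split_ifs <;> omega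

theorem gtPatterns_shift {n : ℕ} {l : Fin n → ℕ} {R : ℕ → ℕ → ℕ} (hR : R ∈ gtPatterns n l)
    {k s : ℕ} (hs : s < k) (d : ℕ) (hd : k + d ≤ n) :
    R (k + d) s ≤ R k s ∧ R k s + d ≤ R (k + d) (s + d) := by
  induction d with
  | zero => simp
  | succ d ih =>
    have h := ih (by omega)
    have h1 := (hR.2.2 (k + d) s (by omega) (by omega)).1
    have h2 := (hR.2.2 (k + d) (s + d) (by omega) (by omega)).2
    simp only [← Nat.add_assoc]
    omega

theorem gtPatterns_boxRow {a b c : ℕ} {R : ℕ → ℕ → ℕ} (hR : R ∈ gtPatterns (b + a) (boxRow a b c))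
    {k s : ℕ} (hk : k ≤ b + a) (hs : s < k) :
    s ≤ R k s ∧ R k s ≤ s + c ∧ (b ≤ s → R k s = s + c) ∧ (s + a < k → s < b → R k s = s) := by
  obtain ⟨d, hd⟩ := Nat.exists_eq_add_of_le hk
  have h := gtPatterns_shift hR hs d hd.ge
  have h1 := hR.1 ⟨s, by omega⟩
  have h2 := hR.1 ⟨s + d, by omega⟩
  simp only [boxRow] at h1 h2
  rw [← hd] at h
  split_ifs at h1 h2 <;> omega

/-- Plane partitions in a box as Gelfand–Tsetlin patterns. -/
def boxArraysEquivGTPatterns (a b c : ℕ) :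
    boxArrays a b c ≃ gtPatterns (b + a) (boxRow a b c) where
  toFun G := ⟨fun k s => if k ≤ b + a ∧ s < k then G.1 (k - 1 - s) s + s else 0, by
    obtain ⟨G, hG⟩ := G
    refine ⟨fun s => ?_, fun k s hk => if_neg (by omega), fun k s hk hs => ?_⟩
    · have := s.2
      dsimp only
      rw [if_pos (by omega), boxRow]
      split_ifs with h
      · rw [hG.2.2 _ _ (by omega) h, zero_add]
      · rw [hG.2.1 _ _ (by omega), add_comm]
    · dsimp only
      rw [if_pos (by omega), if_pos (by omega), if_pos (by omega)]
      have h1 := (hG.1 (k - 1 - s) s).1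
      have h2 := (hG.1 (k - 1 - s) s).2
      rw [show k - 1 - s + 1 = k + 1 - 1 - s by omega] at h1
      rw [show k + 1 - 1 - (s + 1) = k - 1 - s by omega]
      omega⟩
  invFun R := ⟨fun p r => if b ≤ r then c else if a ≤ p then 0 else R.1 (p + r + 1) r - r, by
    obtain ⟨R, hR⟩ := R
    refine ⟨fun p r => ?_, fun p r h => by simp [h], fun p r hp hr => ?_⟩
    · dsimp only
      constructor
      · split_ifs
        · exact le_rfl
        · exact le_rfl
        · exact Nat.zero_le _
        · omega
        · have := (hR.2.2 (p + r + 1) r (by omega) (by omega)).1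
          rw [show p + 1 + r + 1 = p + r + 1 + 1 by omega]
          omega
      · split_ifs <;> first | omega | exact Nat.zero_le _ | skip
        · have := (gtPatterns_boxRow hR (k := p + r + 1) (s := r) (by omega) (by omega)).2.1
          omega
        · have := (hR.2.2 (p + r + 1) r (by omega) (by omega)).2
          rw [show p + (r + 1) + 1 = p + r + 1 + 1 by omega]
          omega
    · simp [hp, Nat.not_le.2 hr]⟩
  left_inv G := by
    refine Subtype.ext ?_
    funext p r
    dsimp only
    split_ifs with hr hp h
    · exact (G.2.2.1 p r hr).symm
    · exact (G.2.2.2 p r hp (by omega)).symm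
    · rw [show p + r + 1 - 1 - r = p by omega]
      omega
    · omega
  right_inv R := by
    obtain ⟨R, hR⟩ := R
    refine Subtype.ext ?_
    funext k s
    dsimp only
    split_ifs with h hs hk
    · have := gtPatterns_boxRow hR h.1 h.2
      omega
    · have := gtPatterns_boxRow hR h.1 h.2
      omega
    · have := gtPatterns_boxRow hR h.1 h.2
      rw [show k - 1 - s + s + 1 = k by omega]
      omega
    · exact (hR.2.1 k s (by omega)).symm

theorem card_planePartitions (a b c : ℕ) :
    (Nat.card {f : Fin a → Fin b → ℕ //
        (∀ i i' j j', i ≤ i' → j ≤ j' → f i' j' ≤ f i j) ∧ (∀ i j, f i j ≤ c)} : ℚ) =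
      ∏ i ∈ Finset.Icc 1 a, ∏ j ∈ Finset.Icc 1 b, ∏ k ∈ Finset.Icc 1 c,
        ((i + j + k - 1 : ℚ) / (i + j + k - 2)) := by
  rw [Nat.card_congr ((planePartitionEquiv a b c).trans (boxArraysEquivGTPatterns a b c)),
    (card_gtPatterns _ _ (monotone_boxRow a b c)).2, ← chooseDet_rectangle]
  rfl

theorem lt_sInf_compl_iff {Q : ℕ → Prop} (hQ : ∀ z, Q (z + 1) → Q z) (hb : ∃ z, ¬ Q z) (z : ℕ) :
    z < sInf {z | ¬ Q z} ↔ Q z := by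
  refine ⟨fun h => not_not.1 (Nat.notMem_of_lt_sInf h), fun h => ?_⟩
  by_contra hz
  have hanti : ∀ m n, m ≤ n → Q n → Q m := fun m n hmn =>
    Nat.le_induction (P := fun n _ => Q n → Q m) id (fun n _ ih h => ih (hQ n h)) n hmn
  exact Nat.sInf_mem hb (hanti _ _ (not_lt.1 hz) h)

/-- Families of lattice paths across the hexagon: `Y p j` is the number of steps to the left taken
by the `p`-th path below level `j`. -/
def pathFamilies (a b c : ℕ) : Set (ℕ → ℕ → ℕ) :=
  {Y | (∀ p j, Y (p + 1) j ≤ Y p j ∧ Y p j ≤ Y p (j + 1) ∧ Y p (j + 1) ≤ Y p j + 1) ∧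
    (∀ p, Y p 0 = 0) ∧ (∀ p j, b + c ≤ j → Y p j = c) ∧ ∀ p j, a ≤ p → Y p j = min (j - b) c}

theorem pathFamilies_shift {a b c : ℕ} {Y : ℕ → ℕ → ℕ} (hY : Y ∈ pathFamilies a b c) (p j d : ℕ) :
    Y p j ≤ Y p (j + d) ∧ Y p (j + d) ≤ Y p j + d := by
  induction d with
  | zero => simp
  | succ d ih =>
    have := hY.1 p (j + d)
    rw [← add_assoc]
    omega

theorem pathFamilies_bounds {a b c : ℕ} {Y : ℕ → ℕ → ℕ} (hY : Y ∈ pathFamilies a b c) (p j : ℕ) :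
    Y p j ≤ j ∧ Y p j ≤ c ∧ min (j - b) c ≤ Y p j := by
  have h1 := pathFamilies_shift hY p 0 j
  have h2 := pathFamilies_shift hY p j (b + c - j)
  have h3 := hY.2.1 p
  have h4 := hY.2.2.1 p (j + (b + c - j)) (by omega)
  rw [zero_add] at h1
  omega

/-- The path family of a plane partition; its `p`-th path is the boundary of the `p`-th row. -/
noncomputable def boxArraysEquivPathFamilies (a b c : ℕ) :
    boxArrays a b c ≃ pathFamilies a b c :=
  have hG : ∀ G ∈ boxArrays a b c, ∀ p j z,
      z < sInf {z | ¬ (z < j ∧ z < G p (j - 1 - z))} ↔ z < j ∧ z < G p (j - 1 - z) := by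
    intro G hG p j
    refine lt_sInf_compl_iff (fun z h => ⟨by omega, ?_⟩) ⟨j, by simp⟩
    exact (Nat.lt_of_succ_lt h.2).trans_le (boxArrays_mono hG le_rfl (by omega))
  have hY : ∀ Y ∈ pathFamilies a b c, ∀ p r z,
      z < sInf {z | ¬ z < Y p (r + 1 + z)} ↔ z < Y p (r + 1 + z) := by
    intro Y hY p r
    refine lt_sInf_compl_iff (fun z h => ?_) ⟨c, ?_⟩
    · have := (hY.1 p (r + 1 + z)).2.2
      rw [← add_assoc] at h
      omega
    · exact not_lt.2 (pathFamilies_bounds hY p _).2.1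
  { toFun := fun G => ⟨fun p j => sInf {z | ¬ (z < j ∧ z < G.1 p (j - 1 - z))}, by
      obtain ⟨G, h⟩ := G
      have h1 := hG G h
      refine ⟨fun p j => ⟨?_, ?_, ?_⟩, fun p => ?_, fun p j hj => ?_, fun p j hp => ?_⟩
      · refine le_of_forall_lt fun z => ?_
        rw [h1, h1]
        exact fun hz => ⟨hz.1, hz.2.trans_le (h.1 _ _).1⟩
      · refine le_of_forall_lt fun z => ?_
        rw [h1, h1]
        exact fun hz => ⟨by omega, hz.2.trans_le (boxArrays_mono h le_rfl (by omega))⟩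
      · refine le_of_forall_lt fun z => ?_
        rw [h1]
        rcases z with _ | z
        · exact fun _ => Nat.succ_pos _
        · intro hz
          rw [show j + 1 - 1 - (z + 1) = j - 1 - z by omega] at hz
          exact Nat.succ_lt_succ ((h1 _ _ _).2 (by omega))
      · refine eq_of_forall_lt_iff fun z => ?_
        rw [h1]
        omega
      · refine eq_of_forall_lt_iff fun z => ?_
        rw [h1]
        have h2 := boxArrays_le h p (j - 1 - z)
        have h3 := h.2.1 p (j - 1 - z)
        omega
      · refine eq_of_forall_lt_iff fun z => ?_
        rw [h1]
        have h2 := h.2.2 p (j - 1 - z) hp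
        have h3 := h.2.1 p (j - 1 - z)
        omega⟩
    invFun := fun Y => ⟨fun p r => sInf {z | ¬ z < Y.1 p (r + 1 + z)}, by
      obtain ⟨Y, h⟩ := Y
      have h1 := hY Y h
      refine ⟨fun p r => ⟨?_, ?_⟩, fun p r hr => ?_, fun p r hp hr => ?_⟩
      · refine le_of_forall_lt fun z => ?_
        rw [h1, h1]
        exact fun hz => hz.trans_le (h.1 _ _).1
      · refine le_of_forall_lt fun z => ?_
        rw [h1, h1, show r + 1 + 1 + z = r + 1 + z + 1 by omega]
        exact fun hz => hz.trans_le (h.1 _ _).2.1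
      · refine eq_of_forall_lt_iff fun z => ?_
        rw [h1]
        have := pathFamilies_bounds h p (r + 1 + z)
        omega
      · refine eq_of_forall_lt_iff fun z => ?_
        rw [h1, h.2.2.2 p _ hp]
        omega⟩
    left_inv := fun ⟨G, h⟩ => by
      refine Subtype.ext ?_
      funext p r
      refine eq_of_forall_lt_iff fun z => ?_
      rw [hY _ (Subtype.mem _)]
      dsimp only
      rw [hG G h, show r + 1 + z - 1 - z = r by omega]
      omega
    right_inv := fun ⟨Y, h⟩ => by
      refine Subtype.ext ?_
      funext p j
      refine eq_of_forall_lt_iff fun z => ?_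
      rw [hG _ (Subtype.mem _)]
      dsimp only
      rw [hY Y h]
      have h2 := (pathFamilies_bounds h p j).1
      by_cases hz : z < j
      · rw [show j - 1 - z + 1 + z = j by omega]
        omega
      · omega }

/-- Exactly one of three propositions holds. -/
def ExactlyOne (P Q R : Prop) : Prop := (P ∨ Q ∨ R) ∧ ¬ (P ∧ Q) ∧ ¬ (P ∧ R) ∧ ¬ (Q ∧ R)

theorem covers_up_iff (i j k l : ℤ) (d : Fin 3) :
    covers (i, j, d) (k, l, false) ↔ k = i ∧ l = j := by
  fin_cases d <;> simp [covers]

theorem covers_down_iff (i j k l : ℤ) (d : Fin 3) :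
    covers (i, j, d) (k, l, true) ↔ (d = 0 ∧ k = i ∧ l = j) ∨ (d = 1 ∧ k = i - 1 ∧ l = j) ∨
      (d = 2 ∧ k = i ∧ l = j - 1) := by
  fin_cases d <;> simp [covers]

theorem existsUnique_mem_iff_exactlyOne {α : Type*} (T : Set α) {x y z : α} (hxy : x ≠ y)
    (hxz : x ≠ z) (hyz : y ≠ z) :
    (∃! t, t ∈ T ∧ (t = x ∨ t = y ∨ t = z)) ↔ ExactlyOne (x ∈ T) (y ∈ T) (z ∈ T) := by
  constructor
  · rintro ⟨t, ⟨ht, h⟩, hu⟩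
    refine ⟨?_, fun h' => ?_, fun h' => ?_, fun h' => ?_⟩
    · rcases h with rfl | rfl | rfl <;> simp [ht]
    · exact hxy ((hu x ⟨h'.1, by simp⟩).trans (hu y ⟨h'.2, by simp⟩).symm)
    · exact hxz ((hu x ⟨h'.1, by simp⟩).trans (hu z ⟨h'.2, by simp⟩).symm)
    · exact hyz ((hu y ⟨h'.1, by simp⟩).trans (hu z ⟨h'.2, by simp⟩).symm)
  · rintro ⟨h | h | h, h1, h2, h3⟩
    · refine ⟨x, ⟨h, by simp⟩, ?_⟩
      rintro t ⟨ht, rfl | rfl | rfl⟩ <;> simp_all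
    · refine ⟨y, ⟨h, by simp⟩, ?_⟩
      rintro t ⟨ht, rfl | rfl | rfl⟩ <;> simp_all
    · refine ⟨z, ⟨h, by simp⟩, ?_⟩
      rintro t ⟨ht, rfl | rfl | rfl⟩ <;> simp_all

theorem existsUnique_up_iff (T : Set Tile) (i j : ℤ) :
    (∃! t, t ∈ T ∧ covers t (i, j, false)) ↔
      ExactlyOne ((i, j, 0) ∈ T) ((i, j, 1) ∈ T) ((i, j, 2) ∈ T) := by
  have hc : ∀ t : Tile, covers t (i, j, false) ↔
      t = (i, j, 0) ∨ t = (i, j, 1) ∨ t = (i, j, 2) := by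
    rintro ⟨k, l, d⟩
    rw [covers_up_iff]
    simp only [Prod.mk.injEq]
    have hd : d = 0 ∨ d = 1 ∨ d = 2 := by
      revert d
      decide
    rw [eq_comm (a := i), eq_comm (a := j)]
    tauto
  simp only [hc]
  exact existsUnique_mem_iff_exactlyOne T (by simp) (by simp) (by simp)

theorem existsUnique_down_iff (T : Set Tile) (i j : ℤ) :
    (∃! t, t ∈ T ∧ covers t (i, j, true)) ↔
      ExactlyOne ((i, j, 0) ∈ T) ((i + 1, j, 1) ∈ T) ((i, j + 1, 2) ∈ T) := by
  have hc : ∀ t : Tile, covers t (i, j, true) ↔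
      t = (i, j, 0) ∨ t = (i + 1, j, 1) ∨ t = (i, j + 1, 2) := by
    rintro ⟨k, l, d⟩
    rw [covers_down_iff]
    simp only [Prod.mk.injEq]
    constructor
    · rintro (⟨rfl, rfl, rfl⟩ | ⟨rfl, rfl, rfl⟩ | ⟨rfl, rfl, rfl⟩) <;> simp
    · rintro (⟨rfl, rfl, rfl⟩ | ⟨rfl, rfl, rfl⟩ | ⟨rfl, rfl, rfl⟩) <;> simp
  simp only [hc]
  exact existsUnique_mem_iff_exactlyOne T (by simp) (by simp) (by simp)

/-- The upward triangle at `(i, j)` belongs to the hexagon. -/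
def UpIn (a b c : ℕ) (i j : ℤ) : Prop :=
  -(c : ℤ) ≤ i ∧ i ≤ (a : ℤ) - 1 ∧ 0 ≤ j ∧ j ≤ (b : ℤ) + c - 1 ∧ 0 ≤ i + j ∧ i + j ≤ (a : ℤ) + b - 1

/-- The downward triangle at `(i, j)` belongs to the hexagon. -/
def DownIn (a b c : ℕ) (i j : ℤ) : Prop :=
  -(c : ℤ) ≤ i ∧ i ≤ (a : ℤ) - 1 ∧ 0 ≤ j ∧ j ≤ (b : ℤ) + c - 1 ∧ -1 ≤ i + j ∧
    i + j ≤ (a : ℤ) + b - 2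

theorem isTiling_iff (a b c : ℕ) (T : Set Tile) :
    IsTiling a b c T ↔
      ((∀ i j, (i, j, 0) ∈ T → UpIn a b c i j ∧ DownIn a b c i j) ∧
        (∀ i j, (i, j, 1) ∈ T → UpIn a b c i j ∧ DownIn a b c (i - 1) j) ∧
        ∀ i j, (i, j, 2) ∈ T → UpIn a b c i j ∧ DownIn a b c i (j - 1)) ∧
      (∀ i j, UpIn a b c i j → ExactlyOne ((i, j, 0) ∈ T) ((i, j, 1) ∈ T) ((i, j, 2) ∈ T)) ∧
      ∀ i j, DownIn a b c i j →
        ExactlyOne ((i, j, 0) ∈ T) ((i + 1, j, 1) ∈ T) ((i, j + 1, 2) ∈ T) := by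
  have hup : ∀ i j, inHexagon a b c (i, j, false) ↔ UpIn a b c i j := fun i j => by
    simp [inHexagon, UpIn]
  have hdown : ∀ i j, inHexagon a b c (i, j, true) ↔ DownIn a b c i j := fun i j => by
    simp [inHexagon, DownIn]
  simp only [IsTiling, Prod.forall, Bool.forall_bool, hup, hdown, existsUnique_up_iff,
    existsUnique_down_iff, covers_up_iff, covers_down_iff]
  refine and_congr ⟨fun h => ⟨?_, ?_, ?_⟩, ?_⟩ ⟨fun h => ⟨?_, ?_⟩, ?_⟩
  · exact fun i j ht => ⟨(h i j 0 ht i j).1 ⟨rfl, rfl⟩, (h i j 0 ht i j).2 (by simp)⟩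
  · exact fun i j ht => ⟨(h i j 1 ht i j).1 ⟨rfl, rfl⟩, (h i j 1 ht (i - 1) j).2 (by simp)⟩
  · exact fun i j ht => ⟨(h i j 2 ht i j).1 ⟨rfl, rfl⟩, (h i j 2 ht i (j - 1)).2 (by simp)⟩
  · rintro ⟨h0, h1, h2⟩ i j d ht k l
    refine ⟨?_, ?_⟩
    · rintro ⟨rfl, rfl⟩
      fin_cases d
      exacts [(h0 _ _ ht).1, (h1 _ _ ht).1, (h2 _ _ ht).1]
    · rintro (⟨rfl, rfl, rfl⟩ | ⟨rfl, rfl, rfl⟩ | ⟨rfl, rfl, rfl⟩)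
      exacts [(h0 _ _ ht).2, (h1 _ _ ht).2, (h2 _ _ ht).2]
  · exact fun i j => (h i j).1
  · exact fun i j => (h i j).2
  · exact fun h i j => ⟨h.1 i j, h.2 i j⟩

theorem IsTiling.eq_of_subset {a b c : ℕ} {S T : Set Tile} (hS : IsTiling a b c S)
    (hT : IsTiling a b c T) (h : S ⊆ T) : S = T := by
  refine h.antisymm fun t ht => ?_
  have hc : covers t (t.1, t.2.1, false) := Or.inl rfl
  have hx := hT.1 t ht _ hc
  obtain ⟨s, ⟨hs, hsc⟩, -⟩ := hS.2 _ hx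
  rwa [(hT.2 _ hx).unique ⟨ht, hc⟩ ⟨h hs, hsc⟩]

/-- The tiling whose tiles of orientations `0` and `1` are traversed by the paths of `Y`. -/
def pathTiling (a b c : ℕ) (Y : ℕ → ℕ → ℕ) : Set Tile :=
  {t | (t.2.2 = 0 ∧ ∃ p j, p < a ∧ j < b + c ∧ t.1 = (p : ℤ) - Y p j ∧ t.2.1 = (j : ℤ) ∧
        Y p (j + 1) = Y p j) ∨
      (t.2.2 = 1 ∧ ∃ p j, p < a ∧ j < b + c ∧ t.1 = (p : ℤ) - Y p j ∧ t.2.1 = (j : ℤ) ∧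
        Y p (j + 1) = Y p j + 1) ∨
      (t.2.2 = 2 ∧ UpIn a b c t.1 t.2.1 ∧ DownIn a b c t.1 (t.2.1 - 1) ∧
        ∀ p j : ℕ, p < a → t.2.1 = (j : ℤ) → t.1 ≠ (p : ℤ) - Y p j)}

theorem mem_pathTiling_zero {a b c : ℕ} {Y : ℕ → ℕ → ℕ} {i j : ℤ} :
    (i, j, 0) ∈ pathTiling a b c Y ↔ ∃ p k : ℕ, p < a ∧ k < b + c ∧ i = (p : ℤ) - Y p k ∧
      j = (k : ℤ) ∧ Y p (k + 1) = Y p k := by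
  simp [pathTiling]

theorem mem_pathTiling_one {a b c : ℕ} {Y : ℕ → ℕ → ℕ} {i j : ℤ} :
    (i, j, 1) ∈ pathTiling a b c Y ↔ ∃ p k : ℕ, p < a ∧ k < b + c ∧ i = (p : ℤ) - Y p k ∧
      j = (k : ℤ) ∧ Y p (k + 1) = Y p k + 1 := by
  simp [pathTiling]

theorem mem_pathTiling_two {a b c : ℕ} {Y : ℕ → ℕ → ℕ} {i j : ℤ} :
    (i, j, 2) ∈ pathTiling a b c Y ↔ UpIn a b c i j ∧ DownIn a b c i (j - 1) ∧
      ∀ p k : ℕ, p < a → j = (k : ℤ) → i ≠ (p : ℤ) - Y p k := by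
  simp [pathTiling]

theorem pathFamilies_injective {a b c : ℕ} {Y : ℕ → ℕ → ℕ} (hY : Y ∈ pathFamilies a b c)
    {p q j : ℕ} (h : (p : ℤ) - Y p j = (q : ℤ) - Y q j) : p = q := by
  have hm : Antitone fun p => Y p j := antitone_nat_of_succ_le fun p => (hY.1 p j).1
  rcases lt_trichotomy p q with hpq | hpq | hpq
  · have : Y q j ≤ Y p j := hm hpq.le
    omega
  · exact hpq
  · have : Y p j ≤ Y q j := hm hpq.le
    omega

theorem isTiling_pathTiling {a b c : ℕ} {Y : ℕ → ℕ → ℕ} (hY : Y ∈ pathFamilies a b c) :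
    IsTiling a b c (pathTiling a b c Y) := by
  rw [isTiling_iff]
  simp only [mem_pathTiling_zero, mem_pathTiling_one, mem_pathTiling_two]
  refine ⟨⟨?_, ?_, ?_⟩, ?_, ?_⟩
  · rintro i j ⟨p, k, hp, hk, rfl, rfl, h⟩
    have h1 := pathFamilies_bounds hY p k
    have h2 := pathFamilies_bounds hY p (k + 1)
    simp only [UpIn, DownIn]
    omega
  · rintro i j ⟨p, k, hp, hk, rfl, rfl, h⟩
    have h1 := pathFamilies_bounds hY p k
    have h2 := pathFamilies_bounds hY p (k + 1)
    simp only [UpIn, DownIn]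
    omega
  · exact fun i j h => ⟨h.1, h.2.1⟩
  · intro i j hij
    obtain ⟨k, rfl⟩ := Int.eq_ofNat_of_zero_le hij.2.2.1
    have hk : k < b + c := by have := hij.2.2.2.1; omega
    by_cases hpath : ∃ p : ℕ, p < a ∧ i = (p : ℤ) - Y p k
    · obtain ⟨p, hp, rfl⟩ := hpath
      have hq : ∀ q k' : ℕ, (p : ℤ) - Y p k = (q : ℤ) - Y q k' → (k : ℤ) = (k' : ℤ) →
          q = p ∧ k' = k := by
        intro q k' h hk'
        obtain rfl : k = k' := by exact_mod_cast hk'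
        exact ⟨(pathFamilies_injective hY h).symm, rfl⟩
      refine ⟨?_, ?_, ?_, ?_⟩
      · by_cases h : Y p (k + 1) = Y p k
        · exact Or.inl ⟨p, k, hp, hk, rfl, rfl, h⟩
        · have := (hY.1 p k).2
          exact Or.inr (Or.inl ⟨p, k, hp, hk, rfl, rfl, by omega⟩)
      · rintro ⟨⟨q, k', -, -, h1, h2, h3⟩, ⟨q', k'', -, -, h4, h5, h6⟩⟩
        obtain ⟨rfl, rfl⟩ := hq _ _ h1 h2
        obtain ⟨rfl, rfl⟩ := hq _ _ h4 h5
        omega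
      · rintro ⟨-, -, -, h⟩
        exact h p k hp rfl rfl
      · rintro ⟨-, -, -, h⟩
        exact h p k hp rfl rfl
    · have h0 : ∀ p k' : ℕ, p < a → (k : ℤ) = (k' : ℤ) → i ≠ (p : ℤ) - Y p k' := by
        intro p k' hp hk' h
        obtain rfl : k = k' := by exact_mod_cast hk'
        exact hpath ⟨p, hp, h⟩
      refine ⟨Or.inr (Or.inr ⟨hij, ?_, h0⟩), ?_, ?_, ?_⟩
      · have hk0 : k ≠ 0 := by
          rintro rfl
          have h1 := hY.2.1 i.toNat
          have h2 := h0 i.toNat 0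
          simp only [UpIn] at hij
          omega
        simp only [UpIn, DownIn] at hij ⊢
        omega
      · rintro ⟨⟨p, k', hp, -, h1, h2, -⟩, -⟩
        exact h0 p k' hp h2 h1
      · rintro ⟨⟨p, k', hp, -, h1, h2, -⟩, -⟩
        exact h0 p k' hp h2 h1
      · rintro ⟨⟨p, k', hp, -, h1, h2, -⟩, -⟩
        exact h0 p k' hp h2 h1
  · intro i j hij
    obtain ⟨k, rfl⟩ := Int.eq_ofNat_of_zero_le hij.2.2.1
    have hk : k < b + c := by have := hij.2.2.2.1; omega
    by_cases hpath : ∃ p : ℕ, p < a ∧ i = (p : ℤ) - Y p (k + 1)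
    · obtain ⟨p, hp, rfl⟩ := hpath
      have hq : ∀ q k' : ℕ, (p : ℤ) - Y p (k + 1) = (q : ℤ) - Y q (k' + 1) → (k : ℤ) = (k' : ℤ) →
          q = p ∧ k' = k := by
        intro q k' h hk'
        obtain rfl : k = k' := by exact_mod_cast hk'
        exact ⟨(pathFamilies_injective hY h).symm, rfl⟩
      refine ⟨?_, ?_, ?_, ?_⟩
      · by_cases h : Y p (k + 1) = Y p k
        · exact Or.inl ⟨p, k, hp, hk, by rw [h], rfl, h⟩
        · have := (hY.1 p k).2
          exact Or.inr (Or.inl ⟨p, k, hp, hk, by omega, rfl, by omega⟩)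
      · rintro ⟨⟨q, k', -, -, h1, h2, h3⟩, ⟨q', k'', -, -, h4, h5, h6⟩⟩
        obtain ⟨rfl, rfl⟩ := hq q k' (by omega) h2
        obtain ⟨rfl, rfl⟩ := hq q' k'' (by omega) h5
        omega
      · rintro ⟨-, -, -, h⟩
        exact h p (k + 1) hp (by push_cast; rfl) rfl
      · rintro ⟨-, -, -, h⟩
        exact h p (k + 1) hp (by push_cast; rfl) rfl
    · have h0 : ∀ p k' : ℕ, p < a → (k : ℤ) = (k' : ℤ) → i ≠ (p : ℤ) - Y p (k' + 1) := by
        intro p k' hp hk' h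
        obtain rfl : k = k' := by exact_mod_cast hk'
        exact hpath ⟨p, hp, h⟩
      refine ⟨Or.inr (Or.inr ⟨?_, by simpa using hij, ?_⟩), ?_, ?_, ?_⟩
      · have hkt : k + 1 ≠ b + c := by
          intro h
          have h1 := hY.2.2.1 (i + c).toNat (k + 1) h.ge
          have h2 := h0 (i + c).toNat k
          simp only [DownIn] at hij
          omega
        simp only [UpIn, DownIn] at hij ⊢
        omega
      · intro p k' hp hk'
        obtain rfl : k' = k + 1 := by omega
        exact h0 p k hp rfl
      · rintro ⟨⟨p, k', hp, -, h1, h2, h3⟩, -⟩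
        exact h0 p k' hp h2 (by omega)
      · rintro ⟨⟨p, k', hp, -, h1, h2, h3⟩, -⟩
        exact h0 p k' hp h2 (by omega)
      · rintro ⟨⟨p, k', hp, -, h1, h2, h3⟩, -⟩
        exact h0 p k' hp h2 (by omega)

theorem pathTiling_injOn (a b c : ℕ) : Set.InjOn (pathTiling a b c) (pathFamilies a b c) := by
  intro Y hY Z hZ h
  have key : ∀ Y ∈ pathFamilies a b c, ∀ p k : ℕ, p < a → k < b + c →
      (((p : ℤ) - Y p k, (k : ℤ), 0) ∈ pathTiling a b c Y ↔ Y p (k + 1) = Y p k) := by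
    intro Y hY p k hp hk
    rw [mem_pathTiling_zero]
    constructor
    · rintro ⟨q, k', -, -, h1, h2, h3⟩
      obtain rfl : k = k' := by exact_mod_cast h2
      obtain rfl := pathFamilies_injective hY h1
      exact h3
    · exact fun h => ⟨p, k, hp, hk, rfl, rfl, h⟩
  funext p j
  by_cases hp : a ≤ p
  · rw [hY.2.2.2 p j hp, hZ.2.2.2 p j hp]
  by_cases hj : b + c ≤ j
  · rw [hY.2.2.1 p j hj, hZ.2.2.1 p j hj]
  induction j with
  | zero => rw [hY.2.1, hZ.2.1]
  | succ j ih =>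
    have h0 := ih (by omega)
    have h1 := key Y hY p j (by omega) (by omega)
    have h2 := key Z hZ p j (by omega) (by omega)
    rw [← h0, ← h, h1] at h2
    have h3 := (hY.1 p j).2
    have h4 := (hZ.1 p j).2
    omega

open Classical in
/-- Number of steps to the left among the first `j` steps of the path starting at `p` and following
the tiles of `T`. -/
noncomputable def leftSteps (T : Set Tile) (p : ℕ) : ℕ → ℕ
  | 0 => 0
  | j + 1 => if ((p : ℤ) - leftSteps T p j, (j : ℤ), 0) ∈ T then leftSteps T p j
      else leftSteps T p j + 1

theorem leftSteps_succ_of_mem {T : Set Tile} {p j : ℕ}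
    (h : ((p : ℤ) - leftSteps T p j, (j : ℤ), 0) ∈ T) :
    leftSteps T p (j + 1) = leftSteps T p j := if_pos h

theorem leftSteps_succ_of_notMem {T : Set Tile} {p j : ℕ}
    (h : ((p : ℤ) - leftSteps T p j, (j : ℤ), 0) ∉ T) :
    leftSteps T p (j + 1) = leftSteps T p j + 1 := if_neg h

theorem leftSteps_succ (T : Set Tile) (p j : ℕ) :
    leftSteps T p j ≤ leftSteps T p (j + 1) ∧ leftSteps T p (j + 1) ≤ leftSteps T p j + 1 := by
  by_cases h : ((p : ℤ) - leftSteps T p j, (j : ℤ), 0) ∈ T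
  · rw [leftSteps_succ_of_mem h]
    omega
  · rw [leftSteps_succ_of_notMem h]
    omega

/-- The path of a tiling traverses the downward triangle below each position it reaches. -/
theorem leftSteps_step {a b c : ℕ} {T : Set Tile} (hT : IsTiling a b c T) {p j : ℕ}
    (hup : UpIn a b c ((p : ℤ) - leftSteps T p j) j)
    (h2 : ((p : ℤ) - leftSteps T p j, (j : ℤ), 2) ∉ T) :
    DownIn a b c ((p : ℤ) - leftSteps T p (j + 1)) j ∧
      ((p : ℤ) - leftSteps T p (j + 1), ((j + 1 : ℕ) : ℤ), 2) ∉ T := by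
  obtain ⟨⟨hA0, hA1, -⟩, hB, hC⟩ := (isTiling_iff a b c T).1 hT
  have hj : ((j + 1 : ℕ) : ℤ) = j + 1 := by push_cast; rfl
  rw [hj]
  by_cases h : ((p : ℤ) - leftSteps T p j, (j : ℤ), 0) ∈ T
  · rw [leftSteps_succ_of_mem h]
    have hd := (hA0 _ _ h).2
    exact ⟨hd, fun h' => (hC _ _ hd).2.2.1 ⟨h, h'⟩⟩
  · rw [leftSteps_succ_of_notMem h]
    have h1 : ((p : ℤ) - leftSteps T p j, (j : ℤ), 1) ∈ T := by
      have := (hB _ _ hup).1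
      tauto
    have he : (p : ℤ) - ((leftSteps T p j + 1 : ℕ) : ℤ) = (p : ℤ) - leftSteps T p j - 1 := by
      push_cast
      ring
    have hd := (hA1 _ _ h1).2
    rw [he]
    exact ⟨hd, fun h' => (hC _ _ hd).2.2.2 ⟨by rwa [sub_add_cancel], h'⟩⟩

theorem leftSteps_inside {a b c : ℕ} {T : Set Tile} (hT : IsTiling a b c T) {p : ℕ} (hp : p < a)
    (j : ℕ) (hj : j < b + c) :
    UpIn a b c ((p : ℤ) - leftSteps T p j) j ∧ ((p : ℤ) - leftSteps T p j, (j : ℤ), 2) ∉ T := by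
  induction j with
  | zero =>
    refine ⟨by simp only [UpIn, leftSteps]; omega, fun h => ?_⟩
    have := (((isTiling_iff a b c T).1 hT).1.2.2 _ _ h).2.2.2.1
    simp at this
  | succ j ih =>
    have h := ih (by omega)
    have h1 := leftSteps_step hT h.1 h.2
    refine ⟨?_, h1.2⟩
    have h2 := h1.1
    simp only [UpIn, DownIn] at h2 ⊢
    omega

theorem leftSteps_succ_le {a b c : ℕ} {T : Set Tile} (hT : IsTiling a b c T) {p : ℕ}
    (hp : p + 1 < a) (j : ℕ) (hj : j ≤ b + c) : leftSteps T (p + 1) j ≤ leftSteps T p j := by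
  induction j with
  | zero => simp [leftSteps]
  | succ j ih =>
    obtain ⟨⟨hA0, -, -⟩, hB, hC⟩ := (isTiling_iff a b c T).1 hT
    have h := ih (by omega)
    have h1 := leftSteps_succ T p j
    have h2 := leftSteps_succ T (p + 1) j
    by_contra hlt
    have heq : leftSteps T (p + 1) j = leftSteps T p j := by omega
    have h3 : ((p : ℤ) - leftSteps T p j, (j : ℤ), 0) ∈ T := by
      by_contra h3
      have := leftSteps_succ_of_notMem h3
      omega
    have h4 : (((p + 1 : ℕ) : ℤ) - leftSteps T (p + 1) j, (j : ℤ), 0) ∉ T := by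
      intro h4
      have := leftSteps_succ_of_mem h4
      omega
    have h5 := leftSteps_inside hT hp j (by omega)
    have h6 : (((p + 1 : ℕ) : ℤ) - leftSteps T (p + 1) j, (j : ℤ), 1) ∈ T := by
      have := (hB _ _ h5.1).1
      tauto
    refine (hC _ _ (hA0 _ _ h3).2).2.1 ⟨h3, ?_⟩
    rwa [heq, show ((p + 1 : ℕ) : ℤ) - leftSteps T p j = (p : ℤ) - leftSteps T p j + 1 by
      push_cast; ring] at h6

theorem leftSteps_top {a b c : ℕ} (hbc : 0 < b + c) {T : Set Tile} (hT : IsTiling a b c T) {p : ℕ}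
    (hp : p < a) : leftSteps T p (b + c) = c := by
  have hd : ∀ q, q < a → DownIn a b c ((q : ℤ) - leftSteps T q (b + c)) ((b + c : ℕ) - 1) := by
    intro q hq
    have h := leftSteps_inside hT hq (b + c - 1) (by omega)
    have h1 := (leftSteps_step hT h.1 h.2).1
    rw [Nat.sub_add_cancel hbc] at h1
    rwa [Nat.cast_sub hbc] at h1
  have hm : ∀ q d, q + d < a → leftSteps T (q + d) (b + c) ≤ leftSteps T q (b + c) := by
    intro q d hq
    induction d with
    | zero => exact le_rfl
    | succ d ih => exact (leftSteps_succ_le hT hq _ le_rfl).trans (ih (by omega))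
  have h1 := hm 0 p (by omega)
  have h2 := hm p (a - 1 - p) (by omega)
  have h3 := hd 0 (by omega)
  have h4 := hd (a - 1) (by omega)
  rw [zero_add] at h1
  rw [show p + (a - 1 - p) = a - 1 by omega] at h2
  simp only [DownIn] at h3 h4
  omega

/-- Every tile of orientation `0` or `1` lies on a path. -/
theorem exists_leftSteps {a b c : ℕ} {T : Set Tile} (hT : IsTiling a b c T) (j : ℕ) (i : ℤ)
    (h : (i, (j : ℤ), 0) ∈ T ∨ (i, (j : ℤ), 1) ∈ T) :
    ∃ p < a, i = (p : ℤ) - leftSteps T p j := by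
  obtain ⟨⟨hA0, hA1, -⟩, hB, hC⟩ := (isTiling_iff a b c T).1 hT
  have hup : UpIn a b c i j := h.elim (fun h => (hA0 _ _ h).1) fun h => (hA1 _ _ h).1
  induction j generalizing i with
  | zero =>
    refine ⟨i.toNat, ?_, ?_⟩ <;> simp only [UpIn, leftSteps] at hup ⊢ <;> omega
  | succ j ih =>
    have hd : DownIn a b c i j := by
      simp only [UpIn, DownIn] at hup ⊢
      omega
    have h2 : (i, (j : ℤ) + 1, 2) ∉ T := by
      have h3 := hB _ _ hup
      push_cast at h h3
      exact fun h' => h.elim (fun h => h3.2.2.1 ⟨h, h'⟩) fun h => h3.2.2.2 ⟨h, h'⟩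
    have h3 := hC _ _ hd
    rcases h3.1 with h4 | h4 | h4
    · obtain ⟨p, hp, rfl⟩ := ih i (Or.inl h4) (hA0 _ _ h4).1
      exact ⟨p, hp, by rw [leftSteps_succ_of_mem h4]⟩
    · obtain ⟨p, hp, hi⟩ := ih (i + 1) (Or.inr h4) (hA1 _ _ h4).1
      rw [hi] at h4
      have h5 : ((p : ℤ) - leftSteps T p j, (j : ℤ), 0) ∉ T := fun h5 =>
        (hB _ _ (hA0 _ _ h5).1).2.1 ⟨h5, h4⟩
      refine ⟨p, hp, ?_⟩
      rw [leftSteps_succ_of_notMem h5]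
      push_cast
      omega
    · exact absurd h4 h2

/-- The path family of a tiling. -/
noncomputable def tilingPaths (a b c : ℕ) (T : Set Tile) (p j : ℕ) : ℕ :=
  if p < a then leftSteps T p (min j (b + c)) else min (j - b) c

theorem tilingPaths_mem {a b c : ℕ} (hbc : 0 < b + c) {T : Set Tile} (hT : IsTiling a b c T) :
    tilingPaths a b c T ∈ pathFamilies a b c := by
  refine ⟨fun p j => ?_, fun p => ?_, fun p j hj => ?_, fun p j hp => ?_⟩
  · simp only [tilingPaths]
    refine ⟨?_, ?_⟩
    · by_cases hp : p + 1 < a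
      · rw [if_pos hp, if_pos (by omega)]
        exact leftSteps_succ_le hT hp _ (by omega)
      · rw [if_neg hp]
        split_ifs with hpa
        · by_cases hj : j < b + c
          · have h := (leftSteps_inside hT hpa j hj).1
            rw [min_eq_left hj.le]
            simp only [UpIn] at h
            omega
          · rw [min_eq_right (show b + c ≤ j by omega), leftSteps_top hbc hT hpa]
            omega
        · exact le_rfl
    · split_ifs with hp
      · by_cases hj : j < b + c
        · rw [min_eq_left hj.le, min_eq_left hj]
          exact leftSteps_succ T p j
        · rw [min_eq_right (by omega), min_eq_right (by omega)]
          omega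
      · omega
  · simp only [tilingPaths]
    split_ifs
    · simp [leftSteps]
    · simp
  · simp only [tilingPaths]
    split_ifs with hp
    · rw [min_eq_right hj, leftSteps_top hbc hT hp]
    · omega
  · exact if_neg (by omega)

theorem pathTiling_tilingPaths {a b c : ℕ} (hbc : 0 < b + c) {T : Set Tile}
    (hT : IsTiling a b c T) : pathTiling a b c (tilingPaths a b c T) = T := by
  refine (isTiling_pathTiling (tilingPaths_mem hbc hT)).eq_of_subset hT ?_
  have hZ : ∀ p j, p < a → j ≤ b + c → tilingPaths a b c T p j = leftSteps T p j := by
    intro p j hp hj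
    rw [tilingPaths, if_pos hp, min_eq_left hj]
  obtain ⟨-, hB, -⟩ := (isTiling_iff a b c T).1 hT
  rintro ⟨i, j, d⟩ ht
  have hd : d = 0 ∨ d = 1 ∨ d = 2 := by
    clear ht
    revert d
    decide
  rcases hd with rfl | rfl | rfl
  · obtain ⟨p, k, hp, hk, rfl, rfl, h⟩ := mem_pathTiling_zero.1 ht
    rw [hZ p k hp hk.le, hZ p (k + 1) hp hk] at h
    rw [hZ p k hp hk.le]
    by_contra h'
    have := leftSteps_succ_of_notMem (p := p) (j := k) h'
    omega
  · obtain ⟨p, k, hp, hk, rfl, rfl, h⟩ := mem_pathTiling_one.1 ht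
    rw [hZ p k hp hk.le, hZ p (k + 1) hp hk] at h
    rw [hZ p k hp hk.le]
    obtain ⟨hup, h2⟩ := leftSteps_inside hT hp k hk
    have h0 : ((p : ℤ) - leftSteps T p k, (k : ℤ), 0) ∉ T := by
      intro h'
      have := leftSteps_succ_of_mem (p := p) (j := k) h'
      omega
    have := (hB _ _ hup).1
    tauto
  · obtain ⟨hup, -, h⟩ := mem_pathTiling_two.1 ht
    obtain ⟨k, rfl⟩ := Int.eq_ofNat_of_zero_le hup.2.2.1
    have hk : k < b + c := by have := hup.2.2.2.1; omega
    have h01 : ¬ ((i, (k : ℤ), 0) ∈ T ∨ (i, (k : ℤ), 1) ∈ T) := by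
      intro h'
      obtain ⟨p, hp, hi⟩ := exists_leftSteps hT k i h'
      exact h p k hp rfl (by rw [hZ p k hp hk.le, hi])
    have := (hB _ _ hup).1
    tauto

theorem card_tilings (a b c : ℕ) (hbc : 0 < b + c) :
    Nat.card {T : Set Tile // IsTiling a b c T} =
      Nat.card {f : Fin a → Fin b → ℕ //
        (∀ i i' j j', i ≤ i' → j ≤ j' → f i' j' ≤ f i j) ∧ (∀ i j, f i j ≤ c)} := by
  rw [Nat.card_congr ((planePartitionEquiv a b c).trans (boxArraysEquivPathFamilies a b c))]
  refine (Nat.card_eq_of_bijective (fun Y : pathFamilies a b c =>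
    (⟨pathTiling a b c Y, isTiling_pathTiling Y.2⟩ : {T : Set Tile // IsTiling a b c T}))
    ⟨fun Y Z h => ?_, fun T => ?_⟩).symm
  · exact Subtype.ext (pathTiling_injOn a b c Y.2 Z.2 (congrArg Subtype.val h))
  · exact ⟨⟨_, tilingPaths_mem hbc T.2⟩, Subtype.ext (pathTiling_tilingPaths hbc T.2)⟩

/-- MacMahon's theorem: the number of rhombus tilings of the hexagon with sides
`a,b,c,a,b,c` equals the number of plane partitions in an `a×b×c` box, which
equals `∏_{i=1}^{a} ∏_{j=1}^{b} ∏_{k=1}^{c} (i+j+k-1)/(i+j+k-2)`. -/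
theorem macmahon_box (a b c : ℕ) (ha : 0 < a) (hb : 0 < b) (hc : 0 < c) :
    Nat.card {T : Set Tile // IsTiling a b c T} =
      Nat.card {f : Fin a → Fin b → ℕ //
        (∀ i i' j j', i ≤ i' → j ≤ j' → f i' j' ≤ f i j) ∧ (∀ i j, f i j ≤ c)} ∧
    (Nat.card {f : Fin a → Fin b → ℕ //
        (∀ i i' j j', i ≤ i' → j ≤ j' → f i' j' ≤ f i j) ∧ (∀ i j, f i j ≤ c)} : ℚ) =
      ∏ i ∈ Finset.Icc 1 a, ∏ j ∈ Finset.Icc 1 b, ∏ k ∈ Finset.Icc 1 c,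
        ((i + j + k - 1 : ℚ) / (i + j + k - 2)) := by
  exact ⟨card_tilings a b c (by omega), card_planePartitions a b c⟩
end

section
/- For positive integers N, l with 1 ≤ l ≤ N and variable m, det_{1≤i,j≤N} E(m;N,l)_{i,j} = ∏_{i=1}^{⌊N/2⌋} ( (m+i)_{N−2i+1} (m+i+1/2)_{N−2i} ) · 2^{(N−1)(N−2)/2} · ( (m)_{N+1} ∏_{j=1}^{N}(2j−1)! ) / ( N! ∏_{i=1}^{⌊N/2⌋} (2i)_{2N−4i+1} ) · ∑_{e=0}^{l−1} (−1)^e C(N,e) (N−2e)(1/2)_e / ( (m+e)(m+N−e)(1/2−N)_e ), where E(m;N,l)_{i,j} = (N+m−i)!/((m+i−j)!(N+j−2i+1)!) · (m+(N−j+1)/2) if i ≠ l, and E(m;N,l)_{i,j} = (N+m−i)!/((m+i−j)!(N+j−2i)!) if i = l, with the convention 1/n! = 0 for negative integers n. -/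
/-- The shifted factorial (Pochhammer symbol) `(x)_k = x(x+1)⋯(x+k-1)`. -/
def poch (x : ℚ) (k : ℕ) : ℚ := ∏ t ∈ Finset.range k, (x + t)

/-- The reciprocal of the factorial of an integer, with the convention
`1/n! = 0` for negative `n`. -/
def invFact (z : ℤ) : ℚ := if 0 ≤ z then ((z.toNat.factorial : ℚ))⁻¹ else 0

open Finset Polynomial

lemma poch_succ (x : ℚ) (k : ℕ) : poch x (k + 1) = poch x k * (x + k) :=
  prod_range_succ _ _

lemma poch_succ_left (x : ℚ) (k : ℕ) : poch x (k + 1) = x * poch (x + 1) k := by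
  rw [poch, prod_range_succ', mul_comm, poch]
  congr 1
  · simp
  · exact prod_congr rfl fun t _ => by push_cast; ring

lemma poch_pos {x : ℚ} (hx : 0 < x) (k : ℕ) : 0 < poch x k :=
  prod_pos fun t _ => by positivity

/-- The polynomial `∏_{i<r} (a-i)(a+i+1)` as a function of `a`. -/
def newton (r : ℕ) (a : ℚ) : ℚ := ∏ i ∈ range r, (a - i) * (a + i + 1)

lemma newton_succ (r : ℕ) (a : ℚ) : newton (r + 1) a = newton r a * ((a - r) * (a + r + 1)) :=
  prod_range_succ _ _

lemma newton_shift (r : ℕ) (a : ℚ) :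
    newton r (a + 1) * (a + 1 - r) = newton r a * (a + r + 1) := by
  induction r with
  | zero => simp [newton]
  | succ r ih =>
    rw [newton_succ, newton_succ]
    push_cast
    linear_combination (a - r) * (a + r + 2) * ih

/-- The coefficient of `newton (N - d)` in the Newton expansion of
`∏_{c<N} (a(a+1) - (x+c)(x+c+1))`. -/
def newtonCoeff (N : ℕ) (x : ℚ) : ℕ → ℚ
  | 0 => 1
  | d + 1 => -((N : ℚ) - d) * (x + d) * (x + N - d) / (d + 1) * newtonCoeff N x d

lemma newtonCoeff_succ_mul (N : ℕ) (x : ℚ) (d : ℕ) : (d + 1) * newtonCoeff N x (d + 1) =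
    -((N : ℚ) - d) * (x + d) * (x + N - d) * newtonCoeff N x d := by
  rw [newtonCoeff]
  have : (d : ℚ) + 1 ≠ 0 := by positivity
  field_simp

/-- The quotient of `∏_{c<N} (s - (x+c)(x+c+1))` by the Newton polynomial of degree `N - d`. -/
noncomputable def newtonTail (N : ℕ) (x : ℚ) : ℕ → ℚ[X]
  | 0 => 1
  | d + 1 => (X - C (((N : ℚ) - d - 1) * (N - d))) * newtonTail N x d + C (newtonCoeff N x (d + 1))

/-- `newtonTail` as a function of `a`, where `s = a(a+1)`. -/
noncomputable def tailAt (N : ℕ) (x : ℚ) (d : ℕ) (a : ℚ) : ℚ :=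
  (newtonTail N x d).eval (a * (a + 1))

lemma tailAt_zero (N : ℕ) (x a : ℚ) : tailAt N x 0 a = 1 := by simp [tailAt, newtonTail]

lemma tailAt_succ (N : ℕ) (x a : ℚ) (d : ℕ) :
    tailAt N x (d + 1) a =
      (a - (N - d - 1)) * (a + (N - d)) * tailAt N x d a + newtonCoeff N x (d + 1) := by
  simp [tailAt, newtonTail]
  left
  ring

lemma tailAt_contiguous (N : ℕ) (x : ℚ) (d : ℕ) (b : ℚ) :
    (b + N - d) * (N + x - b) * (b + x) * tailAt N x d b +
      (b - N + d) * (b - x) * (b + x + N) * tailAt N x d (b - 1) =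
      -2 * (d + 1) * newtonCoeff N x (d + 1) := by
  induction d with
  | zero =>
    have := newtonCoeff_succ_mul N x 0
    simp only [tailAt_zero]
    push_cast at *
    rw [newtonCoeff] at this
    linear_combination 2 * this
  | succ d ih =>
    have := newtonCoeff_succ_mul N x (d + 1)
    rw [tailAt_succ, tailAt_succ]
    push_cast at *
    linear_combination 2 * this + (b + N - d - 1) * (b - N + d + 1) * ih

/-- The weights of divided differences at the nodes `(x+c)(x+c+1)`, divided by `2(x+c)+1`. -/
def nodeWeight (N : ℕ) (x : ℚ) (c : ℕ) : ℚ :=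
  (-1) ^ (N - 1 - c) / (c.factorial * (N - 1 - c).factorial * poch (2 * x + 1 + c) N)

/-- The weights of divided differences at the nodes `(x+c)^2`, `0 ≤ c ≤ N`, divided by `2(x+c)`. -/
def squareWeight (N : ℕ) (x : ℚ) (c : ℕ) : ℚ :=
  (-1) ^ (N - c) / (c.factorial * (N - c).factorial * poch (2 * x + c) (N + 1))

lemma squareWeight_mul_left {N : ℕ} {x : ℚ} (hx : 0 < x) {c : ℕ} (hc : c < N) :
    squareWeight N x c * ((N - c) * (2 * x + c)) = -nodeWeight N x c := by
  obtain ⟨k, rfl⟩ := Nat.exists_eq_add_of_lt hc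
  have h1 := (poch_pos (x := 2 * x + 1 + c) (by positivity) (c + k + 1)).ne'
  rw [squareWeight, nodeWeight, poch_succ_left, show c + k + 1 - c = k + 1 by omega,
    show c + k + 1 - 1 - c = k by omega, show 2 * x + c + 1 = 2 * x + 1 + c by ring,
    Nat.factorial_succ]
  have h2 : 2 * x + c ≠ 0 := by positivity
  have h3 := c.factorial_ne_zero
  have h4 := k.factorial_ne_zero
  have h5 : (k : ℚ) + 1 ≠ 0 := by positivity
  push_cast
  field_simp
  ring

lemma squareWeight_mul_right {N : ℕ} {x : ℚ} (hx : 0 < x) {c : ℕ} (hc : c < N) :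
    squareWeight N x (c + 1) * ((c + 1) * (2 * x + c + 1 + N)) = nodeWeight N x c := by
  obtain ⟨k, rfl⟩ := Nat.exists_eq_add_of_lt hc
  have h1 := (poch_pos (x := 2 * x + 1 + c) (by positivity) (c + k + 1)).ne'
  rw [squareWeight, nodeWeight, poch_succ, show c + k + 1 - (c + 1) = k by omega,
    show c + k + 1 - 1 - c = k by omega,
    show 2 * x + (c + 1 : ℕ) = 2 * x + 1 + c by push_cast; ring,
    Nat.factorial_succ]
  have h2 : 2 * x + 1 + c + (c + k + 1 : ℕ) ≠ 0 := by positivity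
  have h3 := c.factorial_ne_zero
  have h4 := k.factorial_ne_zero
  have h5 : (c : ℚ) + 1 ≠ 0 := by positivity
  push_cast at *
  field_simp
  ring

/-- Summation by parts for the node weights. -/
lemma sum_squareWeight_mul {x : ℚ} (hx : 0 < x) (N : ℕ) (f g : ℕ → ℚ) :
    ∑ c ∈ range (N + 1), squareWeight N x c *
      ((N - c) * (2 * x + c) * f c + c * (2 * x + c + N) * g c) =
      ∑ c ∈ range N, nodeWeight N x c * (g (c + 1) - f c) := by
  trans ∑ c ∈ range (N + 1), squareWeight N x c * ((N - c) * (2 * x + c) * f c) +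
      ∑ c ∈ range (N + 1), squareWeight N x c * (c * (2 * x + c + N) * g c)
  · rw [← sum_add_distrib]
    exact sum_congr rfl fun c _ => mul_add _ _ _
  rw [sum_range_succ, sum_range_succ' (fun c => squareWeight N x c * (c * (2 * x + c + N) * g c)),
    sub_self, zero_mul, zero_mul, mul_zero, add_zero, Nat.cast_zero, zero_mul, zero_mul, mul_zero,
    add_zero, ← sum_add_distrib]
  refine sum_congr rfl fun c hc => ?_
  have h1 := squareWeight_mul_left hx (mem_range.1 hc)
  have h2 := squareWeight_mul_right hx (mem_range.1 hc)
  push_cast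
  linear_combination f c * h1 + g (c + 1) * h2

/-- The divided difference of `newton i (a) / (2a+1)` at the nodes `a = x, …, x+N-1`. -/
def newtonSum (N : ℕ) (x : ℚ) (i : ℕ) : ℚ := ∑ c ∈ range N, nodeWeight N x c * newton i (x + c)

lemma newtonSum_ratio {x : ℚ} (hx : 0 < x) (N i : ℕ) :
    (2 * N - 3 - 2 * i) * newtonSum N x (i + 1) =
      -(2 * i + 1) * (x + i + 1) * (x + N - i - 1) * newtonSum N x i := by
  have h := sum_squareWeight_mul hx N
    (fun c => c * (2 * x + c + N) * ((x + c - i) * newton i (x + c)))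
    (fun c => -((N - c) * (2 * x + c) * ((x + c - i) * newton i (x + c))))
  have h0 : ∀ c ∈ range (N + 1), squareWeight N x c *
      ((N - c) * (2 * x + c) * (c * (2 * x + c + N) * ((x + c - i) * newton i (x + c)))
        + c * (2 * x + c + N) * -((N - c) * (2 * x + c) * ((x + c - i) * newton i (x + c)))) = 0 :=
    fun c _ => by ring
  rw [sum_eq_zero h0] at h
  rw [newtonSum, newtonSum, mul_sum, mul_sum, ← sub_eq_zero, ← sum_sub_distrib, ← neg_eq_zero, h,
    ← sum_neg_distrib]
  refine sum_congr rfl fun c _ => ?_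
  have hs := newton_shift i (x + c)
  rw [newton_succ]
  push_cast
  rw [← add_assoc x]
  linear_combination nodeWeight N x c * (N - (c + 1)) * (2 * x + (c + 1)) * hs

lemma sum_squareWeight_newton {x : ℚ} (hx : 0 < x) (N k : ℕ) :
    2 * N * ∑ c ∈ range (N + 1), squareWeight N x c * ((x + c) * (newton k (x + c) * (x + c - k)))
      = (2 * k + 1) * newtonSum N x k := by
  have h := sum_squareWeight_mul hx N (fun c => newton k (x + c) * (x + c - k))
    (fun c => newton k (x + c) * (x + c - k))
  rw [newtonSum, mul_sum, mul_sum]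
  trans ∑ c ∈ range (N + 1), squareWeight N x c *
      ((N - c) * (2 * x + c) * (newton k (x + c) * (x + c - k)) +
        c * (2 * x + c + N) * (newton k (x + c) * (x + c - k)))
  · exact sum_congr rfl fun c _ => by ring
  · rw [h]
    refine sum_congr rfl fun c _ => ?_
    have hs := newton_shift k (x + c)
    push_cast
    rw [← add_assoc x]
    linear_combination nodeWeight N x c * hs

lemma nodeWeight_succ {x : ℚ} (hx : 0 < x) {N c : ℕ} (hc : c < N) :
    nodeWeight (N + 1) x (c + 1) * ((c + 1) * (2 * x + 2 + c)) = nodeWeight N (x + 1) c := by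
  rw [nodeWeight, nodeWeight, poch_succ_left, show N + 1 - 1 - (c + 1) = N - 1 - c by omega,
    Nat.factorial_succ,
    show 2 * (x + 1) + 1 + (c : ℚ) = 2 * x + 1 + (c + 1 : ℕ) + 1 by push_cast; ring]
  have h1 := (poch_pos (x := 2 * x + 1 + (c + 1 : ℕ) + 1) (by positivity) N).ne'
  have h3 := c.factorial_ne_zero
  have h4 := (N - 1 - c).factorial_ne_zero
  have h5 : (c : ℚ) + 1 ≠ 0 := by positivity
  have h6 : 2 * x + 2 + c ≠ 0 := by positivity
  have h7 : 2 * x + 1 + (c + 1 : ℕ) ≠ 0 := by positivity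
  push_cast at *
  field_simp
  ring

lemma newtonSum_top_succ {x : ℚ} (hx : 0 < x) {N : ℕ} (hN : 0 < N) :
    N * (2 * x + 1) * newtonSum (N + 1) x N =
      (2 * N - 1) * (x + 1) * newtonSum N (x + 1) (N - 1) := by
  obtain ⟨k, rfl⟩ := Nat.exists_eq_succ_of_ne_zero hN.ne'
  have h1 : newtonSum (k + 1) (x + 1) k = newtonSum (k + 2) x (k + 1) -
      (x - k) * (x + k + 1) * newtonSum (k + 2) x k := by
    rw [newtonSum, newtonSum, newtonSum, mul_sum, ← sum_sub_distrib, sum_range_succ' _ (k + 1)]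
    rw [newton_succ]
    trans ∑ c ∈ range (k + 1), nodeWeight (k + 1) (x + 1) c * newton k (x + 1 + c) + 0
    · simp
    congr 1
    · refine sum_congr rfl fun c hc => ?_
      rw [← nodeWeight_succ hx (mem_range.1 hc), newton_succ,
        show x + 1 + (c : ℚ) = x + (c + 1 : ℕ) by push_cast; ring]
      push_cast
      ring
    · push_cast
      ring
  have h2 := newtonSum_ratio hx (k + 2) k
  rw [Nat.succ_eq_add_one, show k + 1 - 1 = k by omega]
  push_cast at *
  linear_combination -(2 * k + 1) * (x + 1) * h1 + (x - k) * h2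

lemma newtonSum_top {N : ℕ} (hN : 0 < N) {x : ℚ} (hx : 0 < x) :
    newtonSum N x (N - 1) * (2 * (N - 1).factorial * poch (x + 1 / 2) N) =
      poch (1 / 2) (N - 1) * poch (x + 1) (N - 1) := by
  induction N, hN using Nat.le_induction generalizing x with
  | base =>
    have : 2 * x + 1 ≠ 0 := by positivity
    simp [newtonSum, nodeWeight, newton, poch]
    field_simp
  | succ N hN ih =>
    have h1 := newtonSum_top_succ hx hN
    have h2 := ih (x := x + 1) (by positivity)
    obtain ⟨k, rfl⟩ := Nat.exists_eq_succ_of_ne_zero (show N ≠ 0 by omega)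
    simp only [Nat.succ_eq_add_one, Nat.add_sub_cancel] at *
    rw [poch_succ_left _ (k + 1), Nat.factorial_succ, poch_succ (1 / 2),
      poch_succ_left (x + 1),
      show x + 1 / 2 + 1 = x + 1 + 1 / 2 by ring]
    push_cast at *
    linear_combination k.factorial * poch (x + 1 + 1/2) (k + 1) * h1 + (k + 1/2) * (x + 1) * h2

/-- The factor by which the determinant with exceptional row `N - 1 - d` differs from a
Vandermonde determinant. -/
noncomputable def momentSum (N : ℕ) (x : ℚ) (d : ℕ) : ℚ :=
  (2 * ((N : ℚ) - 1 - d) + 1) *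
    ∑ c ∈ range N, nodeWeight N x c * (newton (N - 1 - d) (x + c) * tailAt N x d (x + c))

lemma sum_nodeWeight_tailAt {x : ℚ} (hx : 0 < x) {N d k : ℕ} (h : N = k + 2 + d) :
    N * ∑ c ∈ range N, nodeWeight N x c * (newton k (x + c) *
      (2 * ((x + c) * (x + c + 1) + (k + 1) ^ 2) * tailAt N x d (x + c))) =
      2 * (d + 1) * newtonCoeff N x (d + 1) * ((2 * k + 1) * newtonSum N x k) := by
  have habel := sum_squareWeight_mul hx N
    (fun c => -2 * (x + c) * (newton k (x + c) * (x + c - k)) * (x + c + k + 2) *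
      tailAt N x d (x + c))
    (fun c => -2 * (x + c) * (newton k (x + c) * (x + c - k)) * (x + c - k - 2) *
      tailAt N x d (x + c - 1))
  have h1 : ∑ c ∈ range N, nodeWeight N x c * (newton k (x + c) *
      (2 * ((x + c) * (x + c + 1) + (k + 1) ^ 2) * tailAt N x d (x + c))) =
      4 * (d + 1) * newtonCoeff N x (d + 1) * ∑ c ∈ range (N + 1),
        squareWeight N x c * ((x + c) * (newton k (x + c) * (x + c - k))) := by
    rw [mul_sum]
    trans
    · refine .trans (sum_congr rfl fun c _ => ?_) habel.symm
      have hs := newton_shift k (x + c)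
      push_cast
      rw [← add_assoc x, add_sub_cancel_right]
      linear_combination 2 * nodeWeight N x c * (x + c + 1) * (x + c - k - 1) *
        tailAt N x d (x + c) * hs
    · refine sum_congr rfl fun c _ => ?_
      have hc := tailAt_contiguous N x d (x + c)
      have hN : (N : ℚ) = k + 2 + d := by rw [h]; push_cast; ring
      have h2 : x + c + N - d = x + c + k + 2 := by rw [hN]; ring
      have h3 : x + c - N + d = x + c - k - 2 := by rw [hN]; ring
      rw [h2, h3] at hc
      linear_combination -2 * squareWeight N x c * (x + c) * (newton k (x + c) * (x + c - k)) * hc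
  rw [h1, ← sum_squareWeight_newton hx]
  ring

lemma momentSum_succ {x : ℚ} (hx : 0 < x) {N d k : ℕ} (h : N = k + 2 + d) :
    N * (momentSum N x d - momentSum N x (d + 1)) =
      (2 * (d + 1) - N) * (newtonCoeff N x (d + 1) * ((2 * k + 1) * newtonSum N x k)) := by
  have h1 : momentSum N x d - momentSum N x (d + 1) =
      ∑ c ∈ range N, nodeWeight N x c * (newton k (x + c) *
        (2 * ((x + c) * (x + c + 1) + (k + 1) ^ 2) * tailAt N x d (x + c))) -
      newtonCoeff N x (d + 1) * ((2 * k + 1) * newtonSum N x k) := by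
    have hN : (N : ℚ) = k + 2 + d := by rw [h]; push_cast; ring
    rw [momentSum, momentSum, newtonSum, show N - 1 - d = k + 1 by omega,
      show N - 1 - (d + 1) = k by omega]
    simp only [mul_sum]
    rw [← sum_sub_distrib, ← sum_sub_distrib]
    refine sum_congr rfl fun c _ => ?_
    rw [tailAt_succ, newton_succ, hN]
    push_cast
    ring
  rw [h1, mul_sub, sum_nodeWeight_tailAt hx h]
  ring

/-- The terms of the hypergeometric sum on the right-hand side, without the factor `N - 2e`. -/
def hyperTerm (N : ℕ) (x : ℚ) (e : ℕ) : ℚ :=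
  (-1) ^ e * N.choose e * poch (1 / 2) e / ((x + e) * (x + N - e) * poch (1 / 2 - N) e)

lemma poch_half_sub_ne_zero (N e : ℕ) : poch (1 / 2 - N) e ≠ 0 := by
  refine prod_ne_zero_iff.2 fun t _ ht => ?_
  have h : (1 + 2 * t : ℚ) = 2 * N := by linarith
  have h' : 1 + 2 * t = 2 * N := by exact_mod_cast h
  omega

lemma hyperTerm_succ {x : ℚ} (hx : 0 < x) {N e : ℕ} (he : e < N) :
    hyperTerm N x (e + 1) * ((x + e + 1) * (x + N - e - 1) * (1 / 2 - N + e) * (e + 1)) =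
      -hyperTerm N x e * ((N - e) * (1 / 2 + e) * (x + e) * (x + N - e)) := by
  have h1 := poch_half_sub_ne_zero N (e + 1)
  have hc : (N.choose (e + 1) : ℚ) * (e + 1) = N.choose e * (N - e) := by
    have := N.choose_succ_right_eq e
    rw [← Nat.cast_sub he.le]
    exact_mod_cast this
  have hN : (e : ℚ) + 1 ≤ N := by exact_mod_cast he
  have h2 : x + N - e ≠ 0 := by linarith
  have h3 : x + N - e - 1 ≠ 0 := by linarith
  have h4 : x + e ≠ 0 := by positivity
  have h5 : x + e + 1 ≠ 0 := by positivity
  rw [poch_succ, mul_ne_zero_iff] at h1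
  obtain ⟨h6, h7⟩ := h1
  rw [hyperTerm, hyperTerm, poch_succ, poch_succ]
  push_cast
  rw [← add_assoc x, ← sub_sub (x + N)]
  generalize poch (1 / 2 - N) e = p at *
  generalize (1 / 2 - N + e : ℚ) = q at *
  field_simp
  rw [pow_succ]
  linear_combination (-(-1) ^ e * poch (1 / 2) e) * hc

lemma newtonCoeff_mul_newtonSum {x : ℚ} (hx : 0 < x) {N : ℕ} (e k : ℕ) (h : N = e + k + 1) :
    newtonCoeff N x e * ((2 * k + 1) * newtonSum N x k) =
      (2 * N - 1) * newtonSum N x (N - 1) * (x * (x + N)) * hyperTerm N x e := by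
  induction e generalizing k with
  | zero =>
    have h1 : x + N ≠ 0 := by positivity
    rw [newtonCoeff, hyperTerm, show N - 1 = k by omega, h]
    rw [h] at h1
    simp [poch]
    push_cast at h1
    field_simp
    ring
  | succ e ih =>
    have h1 := ih (k + 1) (by omega)
    have h2 := hyperTerm_succ hx (N := N) (e := e) (by omega)
    have h3 := newtonSum_ratio hx N k
    have hN : (N : ℚ) = e + k + 2 := by rw [h]; push_cast; ring
    have h4 : x + e + 1 ≠ 0 := by positivity
    have h5 : x + N - e - 1 ≠ 0 := by rw [hN]; ring_nf; positivity
    have h6 : (1 / 2 - N + e : ℚ) ≠ 0 := by rw [hN]; ring_nf; linarith [k.cast_nonneg (α := ℚ)]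
    have h7 : (e : ℚ) + 1 ≠ 0 := by positivity
    refine mul_right_cancel₀ (mul_ne_zero (mul_ne_zero (mul_ne_zero h4 h5) h6) h7) ?_
    rw [mul_assoc _ (hyperTerm _ _ _), h2]
    have h9 := newtonCoeff_succ_mul N x e
    generalize (2 * (N : ℚ) - 1) * newtonSum N x (N - 1) * (x * (x + N)) = K at h1 ⊢
    rw [hN] at h3 h9 ⊢
    push_cast at h1
    have h8 : (2 * e + 1) * newtonSum N x (k + 1) =
      -(2 * k + 1) * (x + k + 1) * (x + e + 1) * newtonSum N x k := by linear_combination h3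
    linear_combination
      -(2 * k + 1) * newtonSum N x k * (x + e + 1) * (x + k + 1) * (k + 3 / 2) * h9 +
      (k + 2) * (x + e) * (x + k + 2) * (k + 3 / 2) * newtonCoeff N x e * h8 -
      (k + 2) * (x + e) * (x + k + 2) * (e + 1 / 2) * h1

lemma momentSum_eq {x : ℚ} (hx : 0 < x) {N d : ℕ} (hd : d < N) :
    N * momentSum N x d = (2 * N - 1) * newtonSum N x (N - 1) * (x * (x + N)) *
      ∑ e ∈ range (d + 1), (N - 2 * e) * hyperTerm N x e := by
  induction d with
  | zero =>
    have h1 : x + N ≠ 0 := by positivity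
    simp [momentSum, newtonSum, hyperTerm, tailAt_zero, poch]
    field_simp
    ring
  | succ d ih =>
    obtain ⟨k, hk⟩ := Nat.exists_eq_add_of_le hd
    have h1 := momentSum_succ hx (N := N) (d := d) (k := k) (by omega)
    rw [newtonCoeff_mul_newtonSum hx _ _ (by omega)] at h1
    rw [sum_range_succ]
    have h2 := ih (by omega)
    push_cast
    linear_combination h2 - h1

lemma node_sub (x c c' : ℚ) : (x + c) * (x + c + 1) - (x + c') * (x + c' + 1) =
    (c - c') * (2 * x + 1 + c + c') := by ring

lemma prod_range_sub_eq_factorial (c : ℕ) : ∏ i ∈ range c, ((c : ℚ) - i) = c.factorial := by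
  induction c with
  | zero => simp
  | succ c ih =>
    rw [prod_range_succ', Nat.factorial_succ]
    push_cast
    simp only [add_sub_add_right_eq_sub, ih]
    ring

lemma prod_node_sub_mul_nodeWeight {x : ℚ} (hx : 0 < x) {N c : ℕ} (hc : c < N) :
    (∏ c' ∈ (range N).erase c, ((x + c) * (x + c + 1) - (x + c') * (x + c' + 1))) *
      ((2 * (x + c) + 1) * nodeWeight N x c) = 1 := by
  simp only [node_sub]
  induction N, Nat.succ_le_of_lt hc using Nat.le_induction with
  | base =>
    rw [Nat.succ_eq_add_one, range_add_one, erase_insert notMem_range_self, prod_mul_distrib,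
      prod_range_sub_eq_factorial, nodeWeight, poch_succ]
    have h1 := (poch_pos (x := 2 * x + 1 + c) (by positivity) c).ne'
    have h2 : 2 * (x + c) + 1 ≠ 0 := by positivity
    have h3 : 2 * x + 1 + c + c ≠ 0 := by positivity
    have h4 := c.factorial_ne_zero
    change _ * poch (2 * x + 1 + c) c * _ = _
    simp
    field_simp
    ring
  | succ N hN ih =>
    obtain ⟨k, rfl⟩ := Nat.exists_eq_add_of_le hN
    rw [range_add_one, erase_insert_of_ne (by omega), prod_insert (by simp)]
    refine .trans ?_ (ih (by omega))
    generalize ∏ c' ∈ (range (c.succ + k)).erase c, ((c : ℚ) - c') * (2 * x + 1 + c + c') = p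
    rw [nodeWeight, nodeWeight, poch_succ,
      show c.succ + k + 1 - 1 - c = k + 1 by omega, show c.succ + k - 1 - c = k by omega,
      Nat.factorial_succ]
    have h1 := (poch_pos (x := 2 * x + 1 + c) (by positivity) (c.succ + k)).ne'
    have h2 := c.factorial_ne_zero
    have h3 := k.factorial_ne_zero
    have h4 : (k : ℚ) + 1 ≠ 0 := by positivity
    have h5 : 2 * x + 1 + c + (c.succ + k : ℕ) ≠ 0 := by positivity
    push_cast at *
    field_simp
    ring

lemma tailAt_self {x : ℚ} (hx : 0 < x) {N c : ℕ} (hc : c < N) : tailAt N x N (x + c) = 0 := by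
  have hN : newtonCoeff N x (N + 1) = 0 := by simp [newtonCoeff]
  have hcon (b : ℚ) := tailAt_contiguous N x N b
  simp only [hN, mul_zero] at hcon
  induction c with
  | zero =>
    have h := hcon x
    have h1 : (N : ℚ) ≠ 0 := by exact_mod_cast (by omega : N ≠ 0)
    have h2 : x + N - N ≠ 0 := by simpa using hx.ne'
    have h3 : N + x - x ≠ 0 := by simpa using h1
    have h4 : x + x ≠ 0 := by positivity
    simp only [sub_self, mul_zero, zero_mul, add_zero, mul_eq_zero, h2, h3, h4, false_or] at h
    simpa using h
  | succ c ih =>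
    have h := hcon (x + (c + 1 : ℕ))
    rw [show x + (c + 1 : ℕ) - 1 = x + c by push_cast; ring, ih (by omega)] at h
    have h2 : x + (c + 1 : ℕ) + N - N ≠ 0 := by rw [add_sub_cancel_right]; positivity
    have h3 : N + x - (x + (c + 1 : ℕ)) ≠ 0 := by
      have : ((c + 1 : ℕ) : ℚ) < N := by exact_mod_cast hc
      linarith
    have h4 : x + (c + 1 : ℕ) + x ≠ 0 := by positivity
    simpa only [mul_zero, add_zero, mul_eq_zero, h2, h3, h4, false_or] using h

/-- The polynomial `∏_{i<r} (X - i(i+1))`. -/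
noncomputable def newtonPoly (r : ℕ) : ℚ[X] := ∏ i ∈ range r, (X - C (i * (i + 1) : ℚ))

lemma newtonPoly_eval (r : ℕ) (a : ℚ) : (newtonPoly r).eval (a * (a + 1)) = newton r a := by
  rw [newtonPoly, newton, eval_prod]
  exact prod_congr rfl fun i _ => by simp; ring

lemma newtonPoly_monic (r : ℕ) : (newtonPoly r).Monic := monic_prod_X_sub_C _ _

lemma newtonPoly_natDegree (r : ℕ) : (newtonPoly r).natDegree = r := by
  rw [newtonPoly, natDegree_prod_of_monic _ _ fun i _ => monic_X_sub_C _]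
  simp only [natDegree_X_sub_C, sum_const, card_range, smul_eq_mul, mul_one]

lemma newtonTail_monic_natDegree (N : ℕ) (x : ℚ) (d : ℕ) :
    (newtonTail N x d).Monic ∧ (newtonTail N x d).natDegree = d := by
  induction d with
  | zero => simp [newtonTail]
  | succ d ih =>
    have h1 := (monic_X_sub_C (((N : ℚ) - d - 1) * (N - d))).mul ih.1
    have h2 : ((X - C (((N : ℚ) - d - 1) * (N - d))) * newtonTail N x d).natDegree = d + 1 := by
      rw [(monic_X_sub_C _).natDegree_mul ih.1, natDegree_X_sub_C, ih.2, add_comm]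
    have h3 : (C (newtonCoeff N x (d + 1))).degree <
        ((X - C (((N : ℚ) - d - 1) * (N - d))) * newtonTail N x d).degree := by
      rw [degree_eq_natDegree h1.ne_zero, h2]
      exact degree_C_le.trans_lt (by exact_mod_cast d.succ_pos)
    exact ⟨h1.add_of_left h3, by rw [newtonTail, natDegree_add_C, h2]⟩

lemma newtonPoly_mul_newtonTail (N : ℕ) (x : ℚ) (r d : ℕ) (h : r + d = N) :
    ∃ R : ℚ[X], R.degree < r ∧ newtonPoly r * newtonTail N x d + R = newtonTail N x N := by
  induction r generalizing d with
  | zero => exact ⟨0, by simp, by simp [newtonPoly, ← h]⟩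
  | succ r ih =>
    obtain ⟨R, hR, hRN⟩ := ih (d + 1) (by omega)
    refine ⟨R + C (newtonCoeff N x (d + 1)) * newtonPoly r, ?_, ?_⟩
    · refine (degree_add_le _ _).trans_lt (max_lt (hR.trans (by exact_mod_cast r.lt_succ_self)) ?_)
      refine ((degree_mul_le _ _).trans (add_le_of_nonpos_left degree_C_le)).trans_lt ?_
      rw [degree_eq_natDegree (newtonPoly_monic r).ne_zero, newtonPoly_natDegree]
      exact_mod_cast r.lt_succ_self
    · rw [← hRN, newtonTail, newtonPoly, prod_range_succ, ← newtonPoly,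
        show (N : ℚ) = r + d + 1 by rw [← h]; push_cast; ring,
        show ((r : ℚ) + d + 1 - d - 1) * (r + d + 1 - d) = r * (r + 1) by ring]
      ring

lemma sum_eval_mul_nodeWeight {x : ℚ} (hx : 0 < x) {N : ℕ} {P : ℚ[X]} (hP : P.degree < N) :
    ∑ c ∈ range N, P.eval ((x + c) * (x + c + 1)) * ((2 * (x + c) + 1) * nodeWeight N x c) =
      P.coeff (N - 1) := by
  have hinj : Set.InjOn (fun c : ℕ => (x + c) * (x + c + 1)) (range N) := by
    intro c _ c' _ h
    have h1 := node_sub x c c'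
    rw [sub_eq_zero.2 h, eq_comm, mul_eq_zero, or_iff_left (by positivity), sub_eq_zero] at h1
    exact_mod_cast h1
  have h := Lagrange.coeff_eq_sum hinj (P := P) (by simpa using hP)
  rw [card_range] at h
  rw [h]
  refine sum_congr rfl fun c hc => ?_
  have h1 := prod_node_sub_mul_nodeWeight hx (mem_range.1 hc)
  rw [div_eq_mul_inv, eq_inv_of_mul_eq_one_right h1]

lemma sum_newton_mul_tailAt {x : ℚ} (hx : 0 < x) {N r d i : ℕ} (hr : r + d + 1 = N) (hi : i < N) :
    ∑ c ∈ range N, newton i (x + c) *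
      (tailAt N x d (x + c) * ((2 * (x + c) + 1) * nodeWeight N x c)) =
      if i = r then 1 else 0 := by
  obtain ⟨hmonic, hdeg⟩ := newtonTail_monic_natDegree N x d
  rcases le_or_gt i r with hir | hir
  · have hnat : (newtonPoly i * newtonTail N x d).natDegree = i + d := by
      rw [(newtonPoly_monic i).natDegree_mul hmonic, hdeg, newtonPoly_natDegree]
    have hm := (newtonPoly_monic i).mul hmonic
    have h := sum_eval_mul_nodeWeight hx (N := N) (P := newtonPoly i * newtonTail N x d) (by
      rw [degree_eq_natDegree hm.ne_zero, hnat]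
      exact_mod_cast (by omega : i + d < N))
    simp only [eval_mul, newtonPoly_eval, mul_assoc] at h
    refine h.trans ?_
    split_ifs with hi'
    · have := hm.coeff_natDegree
      rwa [hnat, show i + d = N - 1 by omega] at this
    · exact coeff_eq_zero_of_natDegree_lt (by omega)
  · obtain ⟨R, hR, hRN⟩ := newtonPoly_mul_newtonTail N x (r + 1) d (by omega)
    set u : ℚ[X] := ∏ j ∈ Ico (r + 1) i, (X - C (j * (j + 1) : ℚ)) with hu
    have hu_monic : u.Monic := monic_prod_X_sub_C _ _
    have hu_deg : u.natDegree = i - (r + 1) := by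
      rw [hu, natDegree_prod_of_monic _ _ fun i _ => monic_X_sub_C _]
      simp only [natDegree_X_sub_C, sum_const, Nat.card_Ico, smul_eq_mul, mul_one]
    have hprod : newtonPoly i = newtonPoly (r + 1) * u :=
      (prod_range_mul_prod_Ico _ hir).symm
    have hdeg' : (-(R * u)).degree < i := by
      rw [degree_neg, degree_mul, degree_eq_natDegree hu_monic.ne_zero, hu_deg]
      refine (WithBot.add_lt_add_right (by simp) hR).trans_le ?_
      exact_mod_cast (by omega : r + 1 + (i - (r + 1)) ≤ i)
    have h := sum_eval_mul_nodeWeight hx (N := N) (P := -(R * u))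
      (hdeg'.trans (by exact_mod_cast hi))
    have hcoeff : (-(R * u)).coeff (N - 1) = 0 :=
      coeff_eq_zero_of_degree_lt (hdeg'.trans_le (by exact_mod_cast (by omega : i ≤ N - 1)))
    rw [if_neg hir.ne', ← hcoeff, ← h]
    refine sum_congr rfl fun c hc => ?_
    have h1 := congrArg (eval ((x + c) * (x + c + 1))) hRN
    have h2 := tailAt_self hx (mem_range.1 hc)
    rw [← newtonPoly_eval, hprod, ← mul_assoc]
    congr 1
    rw [tailAt] at h2 ⊢
    rw [h2, eval_add, eval_mul] at h1
    simp only [eval_mul, eval_neg]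
    linear_combination u.eval ((x + c) * (x + c + 1)) * h1

lemma Matrix.det_updateRow_of_mulVec_eq_single {n R : Type*} [Fintype n] [DecidableEq n]
    [CommRing R] (A : Matrix n n R) (b y : n → R) (i : n) (h : A.mulVec y = Pi.single i 1) :
    (A.updateRow i b).det = A.det * ∑ j, b j * y j := by
  have h1 : A.adjugate.mulVec (A.mulVec y) = A.det • y := by
    rw [Matrix.mulVec_mulVec, Matrix.adjugate_mul, Matrix.smul_mulVec, Matrix.one_mulVec]
  rw [h, Matrix.mulVec_single_one] at h1
  rw [← Matrix.cramer_transpose_apply, Matrix.cramer_eq_adjugate_mulVec,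
    ← Matrix.adjugate_transpose, mul_sum]
  refine sum_congr rfl fun j _ => ?_
  have := congrFun h1 j
  simp only [Matrix.col_apply, Pi.smul_apply, smul_eq_mul] at this
  change A.adjugate j i * b j = _
  rw [this]
  ring

lemma det_newton (N : ℕ) (x : ℚ) :
    (Matrix.of fun r c : Fin N => newton r (x + c)).det = ∏ i : Fin N, ∏ j ∈ Ioi i,
      ((x + j) * (x + j + 1) - (x + i) * (x + i + 1)) := by
  rw [← Matrix.det_vandermonde (fun c : Fin N => (x + c) * (x + c + 1)),
    Matrix.det_eval_matrixOfPolynomials_eq_det_vandermonde _ (fun r : Fin N => newtonPoly r)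
      (fun r => newtonPoly_natDegree r) (fun r => newtonPoly_monic r), ← Matrix.det_transpose]
  congr 1
  ext r c
  simp [newtonPoly_eval]

lemma det_newton_updateRow {x : ℚ} (hx : 0 < x) {N d : ℕ} (r₀ : Fin N) (h : r₀ + d + 1 = N) :
    (Matrix.of fun r c : Fin N =>
      if r = r₀ then newton r (x + c) / (2 * r.1).factorial else
        newton r (x + c) / (2 * r.1 + 1).factorial * ((2 * (x + c) + 1) / 2)).det =
    (∏ r ∈ range N, (2 * ((2 * r + 1).factorial : ℚ))⁻¹) * (∏ c ∈ range N, (2 * (x + c) + 1)) *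
      (∏ i : Fin N, ∏ j ∈ Ioi i, ((x + j) * (x + j + 1) - (x + i) * (x + i + 1))) *
        (2 * momentSum N x d) := by
  have hv (c : Fin N) : 2 * (x + c) + 1 ≠ 0 := by positivity
  set B := Matrix.of fun r c : Fin N => newton r (x + c) with hB
  set b : Fin N → ℚ := fun c => 2 * (2 * r₀ + 1) * newton r₀ (x + c) / (2 * (x + c) + 1) with hb
  have hcramer := Matrix.det_updateRow_of_mulVec_eq_single B b
    (fun c => tailAt N x d (x + c) * ((2 * (x + c) + 1) * nodeWeight N x c)) r₀ (by
      ext i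
      rw [hB, Matrix.mulVec, dotProduct, Pi.single_apply]
      simp only [Matrix.of_apply, Fin.ext_iff]
      rw [← sum_newton_mul_tailAt hx h i.2, ← Fin.sum_univ_eq_sum_range])
  have hmoment : ∑ c, b c * (tailAt N x d (x + c) * ((2 * (x + c) + 1) * nodeWeight N x c)) =
      2 * momentSum N x d := by
    rw [momentSum, show N - 1 - d = r₀ by omega, ← Fin.sum_univ_eq_sum_range (fun c : ℕ =>
      nodeWeight N x c * (newton r₀ (x + c) * tailAt N x d (x + c))), ← mul_assoc, mul_sum]
    refine sum_congr rfl fun c _ => ?_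
    have hN : (N : ℚ) = r₀ + d + 1 := by exact_mod_cast h.symm
    have := hv c
    rw [hN, hb]
    field_simp
    ring
  rw [← hmoment, ← det_newton, mul_assoc _ B.det, ← hcramer, ← Fin.prod_univ_eq_prod_range,
    ← Fin.prod_univ_eq_prod_range, mul_assoc, ← Matrix.det_mul_row, ← Matrix.det_mul_column]
  congr 1
  ext r c
  have := hv c
  by_cases hr : r = r₀
  · subst hr
    simp only [hb, Matrix.of_apply, if_true, Matrix.updateRow_self, Nat.factorial_succ]
    have := (2 * r.1).factorial_ne_zero
    have : (2 * r + 1 : ℚ) ≠ 0 := by positivity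
    push_cast
    field_simp
  · simp only [hB, Matrix.of_apply, if_neg hr, Matrix.updateRow_ne hr]
    field_simp

lemma invFact_sub_one (z : ℤ) : invFact (z - 1) = z * invFact z := by
  rcases lt_trichotomy z 0 with h | rfl | h
  · rw [invFact, invFact, if_neg (by omega), if_neg (by omega), mul_zero]
  · simp [invFact]
  · obtain ⟨n, rfl⟩ := Int.eq_succ_of_zero_lt h
    rw [invFact, invFact, if_pos (by omega), if_pos (by omega),
      add_sub_cancel_right, Int.toNat_natCast, show ((n : ℤ) + 1).toNat = n + 1 by omega,
      Nat.factorial_succ]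
    have : (n : ℚ) + 1 ≠ 0 := by positivity
    push_cast
    field_simp

lemma newton_natCast (r a : ℕ) : newton r a = (a + r).factorial * invFact (a - r) := by
  induction r with
  | zero =>
    have := a.factorial_ne_zero
    simp [newton, invFact]
    field_simp
  | succ r ih =>
    rw [newton_succ, ih, show (a : ℤ) - (r + 1 : ℕ) = a - r - 1 by push_cast; ring, invFact_sub_one,
      ← add_assoc, Nat.factorial_succ]
    push_cast
    ring

/-- The matrix entries, as functions of the upper and lower parameters of the binomial coefficient;
`p` says whether the row is the exceptional one. -/
def entry (p : Prop) [Decidable p] (n : ℕ) (k : ℤ) : ℚ :=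
  if p then n.factorial * invFact k * invFact (n - k)
  else n.factorial * invFact k * invFact (n - k + 1) * ((n + 1 + k) / 2)

lemma entry_succ (p : Prop) [Decidable p] (n : ℕ) (k : ℤ) :
    entry p (n + 1) k = entry p n k + entry p n (k - 1) := by
  have h1 := invFact_sub_one k
  have h2 := invFact_sub_one (n - k + 1)
  have h3 := invFact_sub_one (n - k + 2)
  rw [add_sub_cancel_right] at h2
  rw [show (n : ℤ) - k + 2 - 1 = n - k + 1 by ring] at h3
  rw [entry, entry, entry, Nat.factorial_succ]
  push_cast at *
  split_ifs
  · rw [h1, h2, show (n : ℤ) + 1 - k = n - k + 1 by ring,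
      show (n : ℤ) - (k - 1) = n - k + 1 by ring]
    ring
  · rw [h1, show (n : ℤ) + 1 - k + 1 = n - k + 2 by ring,
      show (n : ℤ) - (k - 1) + 1 = n - k + 2 by ring, h3]
    ring

lemma sum_choose_mul_entry (p : Prop) [Decidable p] (q n : ℕ) (k : ℤ) :
    ∑ t ∈ range (q + 1), (q.choose t : ℚ) * entry p n (k - t) = entry p (n + q) k := by
  induction q generalizing n with
  | zero => simp
  | succ q ih =>
    have h := sum_choose_succ_mul (fun i _ => entry p n (k - i)) q
    rw [h, ← sum_add_distrib, ← add_assoc n, add_right_comm n, ← ih (n + 1)]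
    refine sum_congr rfl fun t _ => ?_
    rw [entry_succ, ← mul_add]
    push_cast
    rw [sub_sub, add_comm]

lemma entry_natCast (p : Prop) [Decidable p] (r a : ℕ) :
    entry p (a + r) (a - r) =
      if p then newton r a / (2 * r).factorial
      else newton r a / (2 * r + 1).factorial * ((2 * a + 1) / 2) := by
  have h1 : invFact ((a + r : ℕ) - (a - r)) = ((2 * r).factorial : ℚ)⁻¹ := by
    rw [show ((a + r : ℕ) - (a - r) : ℤ) = (2 * r : ℕ) by push_cast; ring]
    rw [invFact, if_pos (by omega), Int.toNat_natCast]
  have h2 : invFact ((a + r : ℕ) - (a - r) + 1) = ((2 * r + 1).factorial : ℚ)⁻¹ := by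
    rw [show ((a + r : ℕ) - (a - r) + 1 : ℤ) = (2 * r + 1 : ℕ) by push_cast; ring]
    rw [invFact, if_pos (by omega), Int.toNat_natCast]
  rw [entry, h1, h2, newton_natCast]
  congr 1
  push_cast
  ring

lemma det_entry (N m : ℕ) (p : Fin N → Prop) [DecidablePred p] :
    (Matrix.of fun i j : Fin N => entry (p i) (N + m - (i + 1)) (m + i - j)).det =
      (Matrix.of fun r c : Fin N => entry (p r.rev) (m + c + r) ((m + c : ℕ) - r)).det := by
  set U : Matrix (Fin N) (Fin N) ℚ := Matrix.of fun j q =>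
    if q ≤ j then ((N - 1 - q).choose (j - q) : ℚ) else 0 with hU
  have hdet : U.det = 1 := by
    rw [Matrix.det_of_isLowerTriangular U fun i j hij => if_neg (not_le.2 hij)]
    exact prod_eq_one fun i _ => by simp [hU]
  rw [← mul_one (Matrix.det _), ← hdet, ← Matrix.det_mul,
    ← Matrix.det_submatrix_equiv_self Fin.revPerm]
  congr 1
  ext r c
  rw [Matrix.submatrix_apply, Matrix.mul_apply]
  simp only [Matrix.of_apply, Fin.revPerm_apply, hU]
  have h := sum_choose_mul_entry (p r.rev) c (N + m - (r.rev + 1)) (m + r.rev - c.rev)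
  rw [Fin.val_rev, Fin.val_rev] at h
  have hc := c.2
  have hr := r.2
  rw [show N + m - (N - (r.1 + 1) + 1) + c = m + c + r by omega,
    show (m : ℤ) + (N - (r.1 + 1) : ℕ) - (N - (c.1 + 1) : ℕ) = (m + c : ℕ) - r by omega] at h
  rw [← h]
  simp only [Fin.val_rev, Fin.le_def]
  rw [Fin.sum_univ_eq_sum_range (fun j : ℕ =>
    entry (p r.rev) (N + m - (N - (r.1 + 1) + 1)) (m + (N - (r.1 + 1) : ℕ) - j) *
      if N - (c.1 + 1) ≤ j then
        ((N - 1 - (N - (c.1 + 1))).choose (j - (N - (c.1 + 1))) : ℚ) else 0)]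
  obtain ⟨k, hk⟩ : ∃ k, k = N - (c.1 + 1) := ⟨_, rfl⟩
  rw [← hk, show range N = range (k + (c + 1)) by congr 1; omega, sum_range_add,
    sum_eq_zero (fun j hj => by rw [if_neg (by simpa using hj), mul_zero]), zero_add]
  refine sum_congr rfl fun t _ => ?_
  rw [if_pos (by omega), show N - 1 - k = c by omega, Nat.add_sub_cancel_left, mul_comm]
  congr 2
  push_cast
  omega

lemma Fin.prod_Ioi_eq_prod_range {M : Type*} [CommMonoid M] (N : ℕ) (f : ℕ → ℕ → M) :
    ∏ i : Fin N, ∏ j ∈ Ioi i, f i j = ∏ j ∈ range N, ∏ i ∈ range j, f i j := by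
  rw [prod_comm' (t' := univ) (s' := fun j => Iio j) (by simp), ← Fin.prod_univ_eq_prod_range]
  refine prod_congr rfl fun j _ => ?_
  rw [← Nat.Iio_eq_range, ← Fin.map_valEmbedding_Iio, prod_map]
  rfl

lemma prod_node_sub (N : ℕ) (x : ℚ) :
    ∏ i : Fin N, ∏ j ∈ Ioi i, ((x + j) * (x + j + 1) - (x + i) * (x + i + 1)) =
      (∏ k ∈ range N, (k.factorial : ℚ)) * ∏ k ∈ range N, poch (2 * x + 1 + k) k := by
  rw [Fin.prod_Ioi_eq_prod_range N fun i j =>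
    (x + j) * (x + j + 1) - (x + i) * (x + i + 1), ← prod_mul_distrib]
  refine prod_congr rfl fun k _ => ?_
  simp only [node_sub]
  rw [prod_mul_distrib, prod_range_sub_eq_factorial, poch]

lemma prod_range_two_mul_add (N : ℕ) (y : ℚ) :
    ∏ k ∈ range N, (2 * (y + k)) = 2 ^ N * poch y N := by
  rw [prod_mul_distrib, prod_const, card_range, poch]

lemma prod_poch_add_two (N : ℕ) (x : ℚ) :
    ∏ k ∈ range (N + 2), poch (2 * x + 1 + k) k =
      (∏ k ∈ range N, poch (2 * (x + 1) + 1 + k) k) *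
        (2 ^ (2 * N + 1) * (poch (x + 1) (N + 1) * poch (x + 1 + 1 / 2) N)) := by
  rw [prod_range_succ', prod_range_succ', poch_succ_left (x + 1)]
  have h : ∏ k ∈ range N, poch (2 * x + 1 + (k + 1 + 1 : ℕ)) (k + 1 + 1) =
      (∏ k ∈ range N, poch (2 * (x + 1) + 1 + k) k) *
        ((2 ^ N * poch (x + 1 + 1) N) * (2 ^ N * poch (x + 1 + 1 / 2) N)) := by
    rw [← prod_range_two_mul_add, ← prod_range_two_mul_add, ← prod_mul_distrib, ← prod_mul_distrib]
    refine prod_congr rfl fun k _ => ?_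
    rw [poch_succ, poch_succ, show 2 * x + 1 + (k + 1 + 1 : ℕ) = 2 * (x + 1) + 1 + k by
      push_cast; ring]
    push_cast
    ring
  rw [h]
  simp [poch]
  ring

lemma prod_Icc_one {M : Type*} [CommMonoid M] (f : ℕ → M) (n : ℕ) :
    ∏ i ∈ Icc 1 n, f i = ∏ i ∈ range n, f (i + 1) := by
  rw [range_eq_Ico, prod_Ico_add']
  rfl

lemma prod_poch_eq_two_pow_mul (N : ℕ) (x : ℚ) :
    ∏ k ∈ range N, poch (2 * x + 1 + k) k = 2 ^ (N.choose 2) *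
      ∏ i ∈ Icc 1 (N / 2), poch (x + i) (N - 2 * i + 1) * poch (x + i + 1 / 2) (N - 2 * i) := by
  induction N using Nat.twoStepInduction generalizing x with
  | zero => simp
  | one => simp [poch]
  | more N ih _ =>
    rw [prod_poch_add_two, ih, prod_Icc_one, prod_Icc_one, show (N + 2) / 2 = N / 2 + 1 by omega,
      prod_range_succ', show N + 2 - 2 * (0 + 1) = N by omega,
      show (N + 2).choose 2 = N.choose 2 + (2 * N + 1) by
        rw [Nat.choose_succ_succ' (N + 1) 1, Nat.choose_succ_succ' N 1]; simp; omega, pow_add]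
    have h : ∀ i : ℕ, x + 1 + (i + 1 : ℕ) = x + (i + 1 + 1 : ℕ) := fun i => by push_cast; ring
    simp only [h, show ∀ i, N + 2 - 2 * (i + 1 + 1) = N - 2 * (i + 1) by omega]
    push_cast
    ring

lemma poch_natCast_mul_factorial (n k : ℕ) :
    poch ((n + 1 : ℕ) : ℚ) k * n.factorial = (n + k).factorial := by
  induction k with
  | zero => simp [poch]
  | succ k ih =>
    rw [poch_succ, ← add_assoc, Nat.factorial_succ]
    push_cast at *
    rw [← ih]
    ring

lemma prod_factorial_eq (N : ℕ) :
    ∏ k ∈ range N, k.factorial = (∏ i ∈ range (N / 2), (2 * i + 1).factorial) *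
      ∏ k ∈ range (N - N / 2), (2 * k).factorial := by
  induction N using Nat.twoStepInduction with
  | zero => simp
  | one => simp
  | more N ih _ =>
    rw [prod_range_succ, prod_range_succ, ih, show (N + 2) / 2 = N / 2 + 1 by omega,
      show N + 2 - (N / 2 + 1) = N - N / 2 + 1 by omega, prod_range_succ, prod_range_succ]
    rcases N.even_or_odd' with ⟨h, rfl | rfl⟩
    · rw [show 2 * h / 2 = h by omega, show 2 * h - h = h by omega]
      ring
    · rw [show (2 * h + 1) / 2 = h by omega, show 2 * h + 1 - h = h + 1 by omega, Nat.mul_succ]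
      ring

lemma prod_poch_two_mul (N : ℕ) :
    (∏ i ∈ Icc 1 (N / 2), poch ((2 * i : ℕ) : ℚ) (2 * N - 4 * i + 1)) *
      ∏ k ∈ range N, (k.factorial : ℚ) = ∏ k ∈ range N, ((2 * k).factorial : ℚ) := by
  have h1 : ∏ k ∈ range N, ((2 * k).factorial : ℚ) =
      (∏ k ∈ range (N - N / 2), ((2 * k).factorial : ℚ)) *
        ∏ i ∈ range (N / 2), ((2 * (N - 1 - i)).factorial : ℚ) := by
    conv_lhs => rw [show N = N - N / 2 + N / 2 by omega, prod_range_add,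
      ← prod_range_reflect _ (N / 2)]
    congr 1
    refine prod_congr rfl fun i hi => ?_
    have := mem_range.1 hi
    congr 3
    omega
  have h2 : ∏ k ∈ range N, (k.factorial : ℚ) = (∏ i ∈ range (N / 2), ((2 * i + 1).factorial : ℚ)) *
      ∏ k ∈ range (N - N / 2), ((2 * k).factorial : ℚ) := by
    exact_mod_cast prod_factorial_eq N
  rw [h1, h2, prod_Icc_one, ← mul_assoc, ← prod_mul_distrib, mul_comm]
  congr 1
  refine prod_congr rfl fun i hi => ?_
  have := mem_range.1 hi
  rw [show 2 * (i + 1) = 2 * i + 1 + 1 by ring, poch_natCast_mul_factorial]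
  congr 2
  omega

lemma prod_factorial_ratio (N m : ℕ) :
    (∏ i ∈ Icc 1 N, ((N + m - i).factorial : ℚ) /
      (((m + i - 1).factorial : ℚ) * ((2 * N - 2 * i + 1).factorial : ℚ))) *
      ∏ j ∈ Icc 1 N, ((2 * j - 1).factorial : ℚ) = 1 := by
  rw [prod_div_distrib, prod_mul_distrib]
  simp only [prod_Icc_one]
  rw [← prod_range_reflect (fun i => ((m + (i + 1) - 1).factorial : ℚ)),
    ← prod_range_reflect (fun i => ((2 * (i + 1) - 1).factorial : ℚ)), div_mul_eq_mul_div,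
    ← prod_mul_distrib, ← prod_mul_distrib]
  refine (div_eq_one_iff_eq (prod_ne_zero_iff.2 fun i _ => by positivity)).2 ?_
  refine prod_congr rfl fun i hi => ?_
  have := mem_range.1 hi
  congr 3 <;> omega

lemma two_pow_mul_poch_half (N : ℕ) :
    2 ^ N * poch (1 / 2) N * ∏ k ∈ range N, ((2 * k).factorial : ℚ) =
      ∏ k ∈ range N, ((2 * k + 1).factorial : ℚ) := by
  rw [← prod_range_two_mul_add, ← prod_mul_distrib]
  refine prod_congr rfl fun k _ => ?_
  rw [Nat.factorial_succ]
  push_cast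
  ring

lemma det_entry_eq {N l m : ℕ} (hl : 1 ≤ l) (hlN : l ≤ N) (hm : 0 < m) :
    (Matrix.of fun i j : Fin N => entry (i.1 + 1 = l) (N + m - (i + 1)) (m + i - j)).det =
      (∏ r ∈ range N, (2 * ((2 * r + 1).factorial : ℚ))⁻¹) *
        (∏ c ∈ range N, (2 * ((m : ℚ) + c) + 1)) *
        ((∏ k ∈ range N, (k.factorial : ℚ)) * ∏ k ∈ range N, poch (2 * m + 1 + k) k) *
        (2 * momentSum N m (l - 1)) := by
  rw [det_entry N m fun i => i.1 + 1 = l, ← prod_node_sub,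
    ← det_newton_updateRow (by exact_mod_cast hm) (⟨N - l, by omega⟩ : Fin N) (by simp; omega)]
  congr 1
  ext r c
  simp only [Matrix.of_apply]
  rw [entry_natCast, Fin.val_rev]
  push_cast
  refine if_congr ?_ rfl rfl
  rw [Fin.ext_iff]
  have := r.2
  dsimp only
  omega

/-- The determinant evaluation for the "complicated part":
`det_{1≤i,j≤N} E(m;N,l)_{i,j}` equals
`∏_{i=1}^{N} (N+m−i)!/((m+i−1)!(2N−2i+1)!)
 · ∏_{i=1}^{⌊N/2⌋}((m+i)_{N−2i+1}(m+i+1/2)_{N−2i}) · 2^{(N−1)(N−2)/2}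
 · (m)_{N+1} ∏_{j=1}^{N}(2j−1)! / (N! ∏_{i=1}^{⌊N/2⌋}(2i)_{2N−4i+1})
 · ∑_{e=0}^{l−1} (−1)^e C(N,e)(N−2e)(1/2)_e/((m+e)(m+N−e)(1/2−N)_e)`,
where `E(m;N,l)_{i,j} = (N+m−i)!/((m+i−j)!(N+j−2i+1)!)·(m+(N−j+1)/2)` for
`i ≠ l` and `E(m;N,l)_{i,j} = (N+m−i)!/((m+i−j)!(N+j−2i)!)` for `i = l`,
with `1/n! = 0` for negative `n`; valid for all positive integers `m`. -/
theorem det_complicated_part (N l : ℕ) (hN : 0 < N) (hl : 1 ≤ l) (hlN : l ≤ N)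
    (m : ℕ) (hm : 0 < m) :
    Matrix.det (Matrix.of fun i j : Fin N =>
      if i.1 + 1 = l then
        ((N + m - (i.1 + 1)).factorial : ℚ) *
          invFact ((m : ℤ) + (i.1 + 1) - (j.1 + 1)) *
          invFact ((N : ℤ) + (j.1 + 1) - 2 * (i.1 + 1))
      else
        ((N + m - (i.1 + 1)).factorial : ℚ) *
          invFact ((m : ℤ) + (i.1 + 1) - (j.1 + 1)) *
          invFact ((N : ℤ) + (j.1 + 1) - 2 * (i.1 + 1) + 1) *
          ((m : ℚ) + ((N : ℚ) - (j.1 + 1) + 1) / 2)) =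
    (∏ i ∈ Finset.Icc 1 N,
        ((N + m - i).factorial : ℚ) /
          (((m + i - 1).factorial : ℚ) * ((2 * N - 2 * i + 1).factorial : ℚ))) *
      (∏ i ∈ Finset.Icc 1 (N / 2),
        poch ((m : ℚ) + i) (N - 2 * i + 1) * poch ((m : ℚ) + i + 1 / 2) (N - 2 * i)) *
      2 ^ ((N - 1) * (N - 2) / 2) *
      (poch (m : ℚ) (N + 1) * ∏ j ∈ Finset.Icc 1 N, ((2 * j - 1).factorial : ℚ)) /
      ((N.factorial : ℚ) * ∏ i ∈ Finset.Icc 1 (N / 2), poch ((2 * i : ℕ) : ℚ) (2 * N - 4 * i + 1)) *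
      ∑ e ∈ Finset.range l,
        (-1 : ℚ) ^ e * (N.choose e : ℚ) * ((N : ℚ) - 2 * e) * poch (1 / 2) e /
          (((m : ℚ) + e) * ((m : ℚ) + N - e) * poch (1 / 2 - (N : ℚ)) e) := by
  have hx : (0 : ℚ) < m := by exact_mod_cast hm
  trans (Matrix.of fun i j : Fin N => entry (i.1 + 1 = l) (N + m - (i + 1)) (m + i - j)).det
  · congr 1
    ext i j
    have hi : ((N + m - (i.1 + 1) : ℕ) : ℤ) = N + m - (i.1 + 1) := by
      have := i.2
      omega
    have hi' : ((N + m - (i.1 + 1) : ℕ) : ℚ) = N + m - (i.1 + 1) := by exact_mod_cast hi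
    simp only [Matrix.of_apply, entry, hi, hi']
    rw [show (N : ℤ) + m - (i.1 + 1) - (m + i - j) = N + (j.1 + 1) - 2 * (i.1 + 1) by ring,
      show (m : ℤ) + i - j = m + (i.1 + 1) - (j.1 + 1) by ring]
    push_cast
    congr 2
    ring
  rw [det_entry_eq hl hlN hm, prod_poch_eq_two_pow_mul]
  have hsum : ∑ e ∈ range l,
      (-1 : ℚ) ^ e * (N.choose e : ℚ) * ((N : ℚ) - 2 * e) * poch (1 / 2) e /
        (((m : ℚ) + e) * ((m : ℚ) + N - e) * poch (1 / 2 - (N : ℚ)) e) =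
      ∑ e ∈ range (l - 1 + 1), (N - 2 * e) * hyperTerm N m e := by
    rw [Nat.sub_add_cancel hl]
    exact sum_congr rfl fun e _ => by rw [hyperTerm]; ring
  have hmoment := momentSum_eq hx (N := N) (d := l - 1) (by omega)
  have htop := newtonSum_top hN hx
  have hratio := prod_factorial_ratio N m
  have hden := prod_poch_two_mul N
  have hhalf := two_pow_mul_poch_half N
  have hodd : ∏ c ∈ range N, (2 * ((m : ℚ) + c) + 1) = 2 ^ N * poch (m + 1 / 2) N := by
    rw [← prod_range_two_mul_add]
    exact prod_congr rfl fun c _ => by ring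
  have hinv : ∏ r ∈ range N, (2 * ((2 * r + 1).factorial : ℚ))⁻¹ =
      (2 ^ N * ∏ r ∈ range N, ((2 * r + 1).factorial : ℚ))⁻¹ := by
    rw [prod_inv_distrib, prod_mul_distrib, prod_const, card_range]
  have hodd0 : ∏ r ∈ range N, ((2 * r + 1).factorial : ℚ) ≠ 0 :=
    prod_ne_zero_iff.2 fun k _ => by positivity
  have heven0 : ∏ r ∈ range N, ((2 * r).factorial : ℚ) ≠ 0 :=
    prod_ne_zero_iff.2 fun k _ => by positivity
  rw [hsum, hodd, hinv]
  generalize ∑ e ∈ range (l - 1 + 1), ((N : ℚ) - 2 * e) * hyperTerm N m e = S at *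
  generalize momentSum N m (l - 1) = μ at *
  generalize ∏ i ∈ Icc 1 (N / 2), poch ((2 * i : ℕ) : ℚ) (2 * N - 4 * i + 1) = D at *
  generalize ∏ k ∈ range N, (k.factorial : ℚ) = F at *
  generalize ∏ k ∈ range N, ((2 * k).factorial : ℚ) = G at *
  generalize ∏ k ∈ range N, ((2 * k + 1).factorial : ℚ) = H at *
  generalize ∏ i ∈ Icc 1 (N / 2),
    poch ((m : ℚ) + i) (N - 2 * i + 1) * poch ((m : ℚ) + i + 1 / 2) (N - 2 * i) = Q at *
  generalize poch ((m : ℚ) + 1 / 2) N = P at *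
  generalize (∏ i ∈ Icc 1 N, ((N + m - i).factorial : ℚ) /
      (((m + i - 1).factorial : ℚ) * ((2 * N - 2 * i + 1).factorial : ℚ))) = A at *
  generalize ∏ j ∈ Icc 1 N, ((2 * j - 1).factorial : ℚ) = B at *
  obtain ⟨n, rfl⟩ := Nat.exists_eq_add_of_lt hN
  simp only [zero_add, Nat.add_sub_cancel] at *
  rw [poch_succ] at hhalf
  rw [poch_succ, poch_succ_left, Nat.factorial_succ, show n * (n + 1 - 2) / 2 = n.choose 2 by
    rw [Nat.choose_two_right]; congr 2,
    Nat.choose_succ_succ' n 1, Nat.choose_one_right, pow_add 2 n (n.choose 2)]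
  generalize newtonSum (n + 1) m n = J at *
  generalize poch (1 / 2) n = p at *
  generalize poch ((m : ℚ) + 1) n = q at *
  have hn0 : (n : ℚ) + 1 ≠ 0 := by positivity
  have hfac := n.factorial_ne_zero
  have hD0 : D ≠ 0 := left_ne_zero_of_mul (hden ▸ heven0)
  push_cast at *
  trans F * 2 ^ n * 2 ^ n.choose 2 * Q * P * 2 * μ / H
  · field_simp
  rw [div_mul_eq_mul_div, div_eq_div_iff (by positivity) (by positivity)]
  linear_combination 2 ^ n * F * Q * 2 ^ n.choose 2 * D * 2 * n.factorial * P * hmoment +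
    2 ^ n * F * Q * 2 ^ n.choose 2 * D * (2 * n + 1) * m * (m + n + 1) * S * htop -
    Q * 2 ^ n.choose 2 * m * q * (m + n + 1) * S * H * hratio +
    Q * 2 ^ n.choose 2 * m * q * (m + n + 1) * S *
      (hhalf + 2 ^ n * p * (2 * n + 1) * hden)
end
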